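/- arXiv:2010.04985 — 2 statements merged into one kernel-verified Lean document; each statement's English description precedes it below -/
import Mathlib

section
/- There exists a universal constant c > 0 such that for every fixed finite alphabet Σ, every fixed ε > 0, and every q ∈ ℕ, there is a threshold n₀ such that for all n ≥ n₀: if Π = Π_1 ∪ ⋯ ∪ Π_k ⊆ Σ^n where each Π_i admits an (ε/2)-tester with q queries and error rate 1/3, then Π admits a sample-based ε-tester with error rate 1/3 and sample complexity at most c·log₂(k+1)·n^{1 − 1/(c·q²·log₂²(q+2))}. -/
open scoped Classical

/-- Decision trees over strings in `Fin n → A` with outputs in `O`: internal nodes are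
labeled by coordinates, with one child per symbol, and leaves are labeled by outputs. -/
inductive DTree (A : Type) (n : ℕ) (O : Type) : Type
  | leaf : O → DTree A n O
  | node : Fin n → (A → DTree A n O) → DTree A n O

namespace DTree

/-- Evaluate a decision tree on input `x`, following the path determined by `x`. -/
def eval {A O : Type} {n : ℕ} : DTree A n O → (Fin n → A) → O
  | leaf b, _ => b
  | node i ts, x => (ts (x i)).eval x

/-- The set of coordinates queried by a decision tree on input `x`. -/
def queries {A O : Type} {n : ℕ} : DTree A n O → (Fin n → A) → Finset (Fin n)
  | leaf _, _ => ∅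
  | node i ts, x => insert i ((ts (x i)).queries x)

/-- The depth (maximum number of queries along a branch) of a decision tree. -/
def depth {A O : Type} [Fintype A] {n : ℕ} : DTree A n O → ℕ
  | leaf _ => 0
  | node _ ts => 1 + Finset.univ.sup fun a => (ts a).depth

end DTree

/-- A randomized local algorithm is modeled as a finite multiset `M` of decision trees,
one per outcome of the coin flips (uniformly distributed).  `prP M x P` is the
probability, over a uniformly random tree of `M`, that the output on input `x`
satisfies `P`. -/
noncomputable def prP {A O : Type} {n : ℕ} (M : Multiset (DTree A n O)) (x : Fin n → A)
    (P : O → Prop) : ℝ :=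
  ((Multiset.countP (fun t => P (t.eval x)) M : ℕ) : ℝ) / ((Multiset.card M : ℕ) : ℝ)

/-- Relative Hamming distance on `Fin n → A`. -/
noncomputable def relDist {A : Type} [DecidableEq A] {n : ℕ} (x y : Fin n → A) : ℝ :=
  ((Finset.univ.filter fun i => x i ≠ y i).card : ℝ) / (n : ℝ)

/-- A sample-based algorithm over `Σⁿ` with outputs in `O`: it selects a random set `Q`
of coordinates by including each coordinate independently with probability `p`, reads
the input restricted to `Q`, and outputs a randomized value in `O` whose distribution
depends only on `Q` and the restriction of the input to `Q`. -/
structure SampleAlg (A : Type) (n : ℕ) (O : Type) [Fintype O] where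
  /-- the sampling probability -/
  p : ℝ
  /-- `out Q x o` is the probability of outputting `o` given sample set `Q` on input `x` -/
  out : Finset (Fin n) → ((Fin n) → A) → O → ℝ
  p_nonneg : 0 ≤ p
  p_le_one : p ≤ 1
  out_nonneg : ∀ Q x o, 0 ≤ out Q x o
  out_sum : ∀ Q x, ∑ o, out Q x o = 1
  local_out : ∀ Q x y, (∀ i ∈ Q, x i = y i) → out Q x = out Q y

namespace SampleAlg

/-- The probability that the output of the sample-based algorithm `N` on input `x`
satisfies `P`, over the binomial choice of the sample set and the internal
randomness. -/
noncomputable def pr {A O : Type} [Fintype O] {n : ℕ} (N : SampleAlg A n O)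
    (x : (Fin n) → A) (P : O → Prop) : ℝ :=
  ∑ Q : Finset (Fin n),
    N.p ^ Q.card * (1 - N.p) ^ (n - Q.card) * ∑ o : O, if P o then N.out Q x o else 0

/-- `N` has sample complexity at most `s`: it enforces the cap `s`, i.e. whenever the
number of sampled coordinates exceeds `s` it ignores the input (outputs arbitrarily,
without reading the samples). -/
def complexityLE {A O : Type} [Fintype O] {n : ℕ} (N : SampleAlg A n O) (s : ℝ) : Prop :=
  ∀ Q : Finset (Fin n), s < (Q.card : ℝ) → ∀ x y, N.out Q x = N.out Q y

end SampleAlg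

/-! ### Binomial expectations -/

namespace UT

noncomputable def bE {n : ℕ} (p : ℝ) (f : Finset (Fin n) → ℝ) : ℝ :=
  ∑ Q : Finset (Fin n), p ^ Q.card * (1 - p) ^ (n - Q.card) * f Q

lemma bE_mono {n : ℕ} {p : ℝ} (h0 : 0 ≤ p) (h1 : p ≤ 1) {f g : Finset (Fin n) → ℝ}
    (h : ∀ Q, f Q ≤ g Q) : bE p f ≤ bE p g := by
  unfold bE
  refine Finset.sum_le_sum fun Q _ => mul_le_mul_of_nonneg_left (h Q) ?_
  have : 0 ≤ 1 - p := by linarith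
  positivity

lemma bE_add {n : ℕ} (p : ℝ) (f g : Finset (Fin n) → ℝ) :
    bE p (fun Q => f Q + g Q) = bE p f + bE p g := by
  unfold bE
  rw [← Finset.sum_add_distrib]
  exact Finset.sum_congr rfl fun Q _ => by ring

lemma bE_mul {n : ℕ} (p c : ℝ) (f : Finset (Fin n) → ℝ) :
    bE p (fun Q => c * f Q) = c * bE p f := by
  unfold bE
  rw [Finset.mul_sum]
  exact Finset.sum_congr rfl fun Q _ => by ring

lemma bE_sum {n : ℕ} {ι : Type*} (p : ℝ) (s : Finset ι) (f : ι → Finset (Fin n) → ℝ) :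
    bE p (fun Q => ∑ i ∈ s, f i Q) = ∑ i ∈ s, bE p (f i) := by
  unfold bE
  rw [Finset.sum_comm]
  exact Finset.sum_congr rfl fun Q _ => by rw [Finset.mul_sum]

lemma bE_subset {n : ℕ} (p : ℝ) (P : Finset (Fin n)) :
    bE p (fun Q => if P ⊆ Q then 1 else 0) = p ^ P.card := by
  have h := Finset.prod_add (fun _ : Fin n => p) (fun i => if i ∈ P then 0 else 1 - p)
    Finset.univ
  have h2 : ∏ i : Fin n, (p + if i ∈ P then 0 else 1 - p) = p ^ P.card := by
    have : ∀ i : Fin n, (p + if i ∈ P then 0 else 1 - p) = if i ∈ P then p else 1 := by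
      intro i; split_ifs <;> ring
    simp only [this]
    rw [Finset.prod_ite]
    simp
  rw [h2] at h
  rw [h, Finset.powerset_univ]
  unfold bE
  refine Finset.sum_congr rfl fun Q _ => ?_
  rw [Finset.prod_const]
  beta_reduce
  by_cases hPQ : P ⊆ Q
  · rw [if_pos hPQ, mul_one]
    congr 1
    have : ∀ i ∈ Finset.univ \ Q, (if i ∈ P then 0 else 1 - p) = 1 - p := by
      intro i hi
      rw [if_neg]
      intro hP
      exact (Finset.mem_sdiff.1 hi).2 (hPQ hP)
    rw [Finset.prod_congr rfl this, Finset.prod_const, Finset.card_univ_sdiff, Fintype.card_fin]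
  · rw [if_neg hPQ, mul_zero]
    obtain ⟨v, hv, hvQ⟩ := Finset.not_subset.1 hPQ
    rw [Finset.prod_eq_zero (i := v)]
    · simp
    · simp [hvQ]
    · simp [hv]

lemma bE_const {n : ℕ} (p c : ℝ) : bE (n := n) p (fun _ => c) = c := by
  have := bE_mul p c (fun Q : Finset (Fin n) => if ∅ ⊆ Q then 1 else 0)
  rw [bE_subset] at this
  simpa using this

lemma bE_card {n : ℕ} (p : ℝ) : bE (n := n) p (fun Q => (Q.card : ℝ)) = p * n := by
  have h : ∀ Q : Finset (Fin n), (Q.card : ℝ) = ∑ v : Fin n, if {v} ⊆ Q then 1 else 0 := by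
    intro Q; simp
  simp only [h]
  rw [bE_sum]
  simp only [bE_subset]
  simp [mul_comm]

/-- weighted petal count -/
noncomputable def X {n : ℕ} {ι : Type*} (G : Finset ι) (w : ι → ℝ) (P : ι → Finset (Fin n))
    (p : ℝ) (Q : Finset (Fin n)) : ℝ :=
  ∑ o ∈ G, if P o ⊆ Q then w o * (p ^ (P o).card)⁻¹ else 0

section
variable {n : ℕ} {ι : Type*} (G : Finset ι) (w : ι → ℝ) (P : ι → Finset (Fin n))
    (p : ℝ) (q : ℕ) (δ : ℝ)

lemma X_nonneg (hw : ∀ o, 0 ≤ w o) (hp : 0 < p) (Q : Finset (Fin n)) : 0 ≤ X G w P p Q := by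
  unfold X
  refine Finset.sum_nonneg fun o _ => ?_
  have := hw o
  split_ifs <;> positivity

lemma moment (hw : ∀ o, 0 ≤ w o) (hp : 0 < p) (hp1 : p ≤ 1) (hq : ∀ o ∈ G, (P o).card ≤ q)
    (hδ0 : 0 ≤ δ)
    (hδ : ∀ v, ∑ o ∈ G with v ∈ P o, w o ≤ δ) (m : ℕ) : ∀ U : Finset (Fin n),
    bE p (fun Q => if U ⊆ Q then X G w P p Q ^ m else 0) ≤
      p ^ U.card * (∑ o ∈ G, w o + δ * (p ^ q)⁻¹ * (U.card + q * m)) ^ m := by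
  induction m with
  | zero =>
    intro U
    simp [bE_subset]
  | succ m ih =>
    intro U
    have hμ : 0 ≤ ∑ o ∈ G, w o := Finset.sum_nonneg fun o _ => hw o
    set C := δ * (p ^ q)⁻¹ with hC
    have hC0 : 0 ≤ C := by positivity
    set μ := ∑ o ∈ G, w o with hμd
    set D := μ + C * (U.card + q * (m + 1)) with hD
    have hD0 : 0 ≤ D := by positivity
    have e1 : ∀ Q, (if U ⊆ Q then X G w P p Q ^ (m + 1) else 0) =
        ∑ o ∈ G, w o * (p ^ (P o).card)⁻¹ * (if U ∪ P o ⊆ Q then X G w P p Q ^ m else 0) := by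
      intro Q
      by_cases hU : U ⊆ Q
      · rw [if_pos hU, pow_succ, mul_comm]
        nth_rewrite 1 [X]
        rw [Finset.sum_mul]
        refine Finset.sum_congr rfl fun o _ => ?_
        by_cases hP : P o ⊆ Q
        · rw [if_pos hP, if_pos (Finset.union_subset hU hP)]
        · rw [if_neg hP, if_neg (fun h => hP (Finset.subset_union_right.trans h))]; simp
      · rw [if_neg hU]
        symm
        refine Finset.sum_eq_zero fun o _ => ?_
        rw [if_neg (fun h => hU (Finset.subset_union_left.trans h)), mul_zero]
    simp only [e1]
    rw [bE_sum]
    simp only [bE_mul]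
    have e2 : ∀ o ∈ G, w o * (p ^ (P o).card)⁻¹ *
        bE p (fun Q => if U ∪ P o ⊆ Q then X G w P p Q ^ m else 0) ≤
        p ^ U.card * D ^ m * (w o + ∑ v ∈ U, if v ∈ P o then w o * (p ^ q)⁻¹ else 0) := by
      intro o ho
      have hwo := hw o
      have hcard : (U ∪ P o).card ≤ U.card + q :=
        (Finset.card_union_le _ _).trans (Nat.add_le_add_left (hq o ho) _)
      have h1 : bE p (fun Q => if U ∪ P o ⊆ Q then X G w P p Q ^ m else 0) ≤
          p ^ (U ∪ P o).card * D ^ m := by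
        refine (ih _).trans ?_
        refine mul_le_mul_of_nonneg_left ?_ (by positivity)
        refine pow_le_pow_left₀ (by positivity) ?_ _
        rw [hD]
        have : ((U ∪ P o).card : ℝ) ≤ U.card + q := by exact_mod_cast hcard
        have h3 : C * (((U ∪ P o).card : ℝ) + q * m) ≤ C * (U.card + q * (m + 1)) :=
          mul_le_mul_of_nonneg_left (by linarith) hC0
        linarith
      have h2 : (p ^ (P o).card)⁻¹ * p ^ (U ∪ P o).card =
          p ^ U.card * (p ^ (U ∩ P o).card)⁻¹ := by
        have := Finset.card_union_add_card_inter U (P o)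
        field_simp
        rw [← pow_add, ← pow_add, this, add_comm]
      have h4 : w o * (p ^ (U ∩ P o).card)⁻¹ ≤
          w o + ∑ v ∈ U, if v ∈ P o then w o * (p ^ q)⁻¹ else 0 := by
        have hnn : ∀ v ∈ U, 0 ≤ (if v ∈ P o then w o * (p ^ q)⁻¹ else 0) := by
          intro v _; split_ifs <;> positivity
        by_cases hE : U ∩ P o = ∅
        · rw [hE]
          have := Finset.sum_nonneg hnn
          simp only [Finset.card_empty, pow_zero, inv_one, mul_one]
          linarith
        · obtain ⟨v, hv⟩ := Finset.nonempty_iff_ne_empty.2 hE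
          rw [Finset.mem_inter] at hv
          have h5 := Finset.single_le_sum hnn hv.1
          rw [if_pos hv.2] at h5
          have h6 : (p ^ (U ∩ P o).card)⁻¹ ≤ (p ^ q)⁻¹ := by
            refine inv_anti₀ (by positivity) (pow_le_pow_of_le_one hp.le hp1 ?_)
            exact (Finset.card_le_card Finset.inter_subset_right).trans (hq o ho)
          have h7 := mul_le_mul_of_nonneg_left h6 hwo
          linarith
      calc _ ≤ w o * (p ^ (P o).card)⁻¹ * (p ^ (U ∪ P o).card * D ^ m) :=
            mul_le_mul_of_nonneg_left h1 (by positivity)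
        _ = w o * ((p ^ (P o).card)⁻¹ * p ^ (U ∪ P o).card) * D ^ m := by ring
        _ = p ^ U.card * D ^ m * (w o * (p ^ (U ∩ P o).card)⁻¹) := by rw [h2]; ring
        _ ≤ _ := mul_le_mul_of_nonneg_left h4 (by positivity)
    refine (Finset.sum_le_sum e2).trans ?_
    rw [← Finset.mul_sum, Finset.sum_add_distrib, Finset.sum_comm]
    push_cast
    rw [← hμd, ← hD, pow_succ, ← mul_assoc]
    refine mul_le_mul_of_nonneg_left ?_ (by positivity)
    rw [hD]
    have h8 : ∑ v ∈ U, ∑ o ∈ G, (if v ∈ P o then w o * (p ^ q)⁻¹ else 0) ≤ C * U.card := by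
      have : ∀ v ∈ U, ∑ o ∈ G, (if v ∈ P o then w o * (p ^ q)⁻¹ else 0) ≤ C := by
        intro v _
        rw [← Finset.sum_filter, ← Finset.sum_mul]
        exact mul_le_mul_of_nonneg_right (hδ v) (by positivity)
      refine (Finset.sum_le_card_nsmul _ _ _ this).trans ?_
      rw [nsmul_eq_mul, mul_comm]
    have : 0 ≤ C * (q * ((m : ℝ) + 1)) := by positivity
    linarith

lemma upper (hw : ∀ o, 0 ≤ w o) (hp : 0 < p) (hp1 : p ≤ 1) (hq : ∀ o ∈ G, (P o).card ≤ q)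
    (hδ0 : 0 ≤ δ)
    (hδ : ∀ v, ∑ o ∈ G with v ∈ P o, w o ≤ δ) (m : ℕ) (τ : ℝ) (hτ : 0 < τ)
    (h : 2 * (∑ o ∈ G, w o + δ * (p ^ q)⁻¹ * (q * m)) ≤ τ) :
    bE p (fun Q => if τ ≤ X G w P p Q then 1 else 0) ≤ (1 / 2) ^ m := by
  have h1 := moment G w P p q δ hw hp hp1 hq hδ0 hδ m ∅
  simp only [Finset.empty_subset, if_true, Finset.card_empty, pow_zero, one_mul, Nat.cast_zero,
    zero_add] at h1
  have h2 : bE p (fun Q => τ ^ m * (if τ ≤ X G w P p Q then 1 else 0)) ≤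
      bE p (fun Q => X G w P p Q ^ m) := by
    refine bE_mono hp.le hp1 fun Q => ?_
    split_ifs with hh
    · rw [mul_one]; exact pow_le_pow_left₀ hτ.le hh _
    · rw [mul_zero]; exact pow_nonneg (X_nonneg G w P p hw hp Q) _
  rw [bE_mul] at h2
  have hμ : 0 ≤ ∑ o ∈ G, w o := Finset.sum_nonneg fun o _ => hw o
  have h3 : (∑ o ∈ G, w o + δ * (p ^ q)⁻¹ * (q * m)) ^ m ≤ (τ * (1 / 2)) ^ m :=
    pow_le_pow_left₀ (by positivity) (by linarith) _
  rw [mul_pow] at h3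
  have h4 := (h2.trans h1).trans h3
  exact le_of_mul_le_mul_left h4 (by positivity)

lemma lower (hw : ∀ o, 0 ≤ w o) (hp : 0 < p) (hp1 : p ≤ 1) (hq : ∀ o ∈ G, (P o).card ≤ q)
    (hδ0 : 0 ≤ δ)
    (hδ : ∀ v, ∑ o ∈ G with v ∈ P o, w o ≤ δ) (τ : ℝ) (hτ : 0 < τ)
    (h : 2 * τ ≤ ∑ o ∈ G, w o) (h' : δ * (p ^ q)⁻¹ * (q * 2) ≤ τ / 50) :
    bE p (fun Q => if τ ≤ X G w P p Q then 0 else 1) ≤ 1 / 10 := by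
  have h1 := moment G w P p q δ hw hp hp1 hq hδ0 hδ 2 ∅
  simp only [Finset.empty_subset, if_true, Finset.card_empty, pow_zero, one_mul, Nat.cast_zero,
    zero_add, Nat.cast_ofNat] at h1
  set μ := ∑ o ∈ G, w o with hμ
  have hE : bE p (fun Q => X G w P p Q) = μ := by
    unfold X
    rw [bE_sum]
    refine Finset.sum_congr rfl fun o _ => ?_
    have := bE_mul p (w o * (p ^ (P o).card)⁻¹) (fun Q => if P o ⊆ Q then 1 else 0)
    rw [bE_subset] at this
    simp only [mul_ite, mul_one, mul_zero] at this
    rw [this]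
    field_simp
  have h2 : bE p (fun Q => (μ ^ 2 / 4) * (if τ ≤ X G w P p Q then 0 else 1)) ≤
      bE p (fun Q => X G w P p Q ^ 2 + ((-2 * μ) * X G w P p Q + μ ^ 2)) := by
    refine bE_mono hp.le hp1 fun Q => ?_
    split_ifs with hh
    · nlinarith [sq_nonneg (X G w P p Q - μ)]
    · push Not at hh
      nlinarith
  rw [bE_mul, bE_add, bE_add, bE_mul, bE_const, hE] at h2
  set η := δ * (p ^ q)⁻¹ * (q * 2) with hη
  have hη0 : 0 ≤ η := by positivity
  have hη1 : η ≤ μ / 100 := by linarith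
  have hμ0 : 0 < μ := by linarith
  have h3 : (μ ^ 2 / 4) * bE p (fun Q => if τ ≤ X G w P p Q then 0 else 1) ≤ (μ ^ 2 / 4) * (1/10) := by
    nlinarith
  exact le_of_mul_le_mul_left h3 (by positivity)

end

/-! ### Abstract local algorithms -/

structure LAlg (A : Type) (n : ℕ) where
  Om : Type
  fin : Fintype Om
  ne : Nonempty Om
  S : Om → (Fin n → A) → Finset (Fin n)
  acc : Om → (Fin n → A) → Prop
  U : Om → Finset (Fin n)
  S_sub : ∀ o x, S o x ⊆ U o
  loc_S : ∀ o x y, (∀ v ∈ S o x, x v = y v) → S o y = S o x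
  loc_acc : ∀ o x y, (∀ v ∈ S o x, x v = y v) → (acc o x ↔ acc o y)

attribute [instance] LAlg.fin LAlg.ne

namespace LAlg
variable {A : Type} {n : ℕ} (a : LAlg A n)

noncomputable def w : ℝ := 1 / (Fintype.card a.Om : ℝ)

lemma w_nonneg : 0 ≤ a.w := by unfold w; positivity

noncomputable def mass (x : Fin n → A) : ℝ := ∑ o with a.acc o x, a.w

noncomputable def deg (v : Fin n) : ℝ := ∑ o with v ∈ a.U o, a.w

noncomputable def ker (δ : ℝ) : Finset (Fin n) := Finset.univ.filter fun v => δ < a.deg v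

noncomputable def G (δ δ' : ℝ) (x : Fin n → A) : Finset a.Om :=
  Finset.univ.filter fun o => a.acc o x ∧ ∀ v ∈ a.S o x, ¬ (δ < a.deg v ∧ a.deg v ≤ δ')

noncomputable def vote (p δ δ' : ℝ) (Q : Finset (Fin n)) (x : Fin n → A) : ℝ :=
  X (a.G δ δ' x) (fun _ => a.w) (fun o => a.S o x \ a.ker δ') p Q

lemma ker_card {B : ℕ} (hB : ∀ o, (a.U o).card ≤ B) {δ : ℝ} (hδ : 0 < δ) :
    ((a.ker δ).card : ℝ) ≤ B / δ := by
  rw [le_div_iff₀ hδ]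
  have h1 : ∑ v : Fin n, a.deg v ≤ B := by
    unfold deg
    simp only [Finset.sum_filter]
    rw [Finset.sum_comm]
    have : ∀ o : a.Om, ∑ v : Fin n, (if v ∈ a.U o then a.w else 0) ≤ a.w * B := by
      intro o
      rw [← Finset.sum_filter, Finset.sum_const, nsmul_eq_mul, mul_comm]
      refine mul_le_mul_of_nonneg_left ?_ a.w_nonneg
      have := hB o
      simp only [Finset.filter_mem_eq_inter, Finset.univ_inter]
      exact_mod_cast this
    refine (Finset.sum_le_sum fun o _ => this o).trans ?_
    rw [Finset.sum_const, Finset.card_univ, nsmul_eq_mul, w]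
    have : (Fintype.card a.Om : ℝ) ≠ 0 := by exact_mod_cast Fintype.card_ne_zero
    field_simp
    exact le_rfl
  have h2 : ∑ v ∈ a.ker δ, a.deg v ≤ ∑ v : Fin n, a.deg v := by
    refine Finset.sum_le_sum_of_subset_of_nonneg (Finset.subset_univ _) fun v _ _ => ?_
    exact Finset.sum_nonneg fun _ _ => a.w_nonneg
  have h3 : (a.ker δ).card • δ ≤ ∑ v ∈ a.ker δ, a.deg v := by
    refine Finset.card_nsmul_le_sum _ _ _ fun v hv => ?_
    exact (Finset.mem_filter.1 hv).2.le
  rw [nsmul_eq_mul] at h3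
  linarith

lemma petal_deg (δ δ' : ℝ) (hδ : 0 ≤ δ) (x : Fin n → A) (v : Fin n) :
    ∑ o ∈ a.G δ δ' x with v ∈ a.S o x \ a.ker δ', a.w ≤ δ := by
  by_cases hv : δ < a.deg v
  · rw [Finset.filter_false_of_mem]
    · simpa using hδ
    · intro o ho hmem
      rw [Finset.mem_sdiff] at hmem
      refine (Finset.mem_filter.1 ho).2.2 v hmem.1 ⟨hv, ?_⟩
      by_contra hc
      exact hmem.2 (Finset.mem_filter.2 ⟨Finset.mem_univ _, not_le.1 hc⟩)
  · refine le_trans ?_ (not_lt.1 hv)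
    unfold deg
    refine Finset.sum_le_sum_of_subset_of_nonneg ?_ fun _ _ _ => a.w_nonneg
    intro o ho
    rw [Finset.mem_filter, Finset.mem_sdiff] at ho
    exact Finset.mem_filter.2 ⟨Finset.mem_univ _, a.S_sub o x ho.2.1⟩

lemma petal_card {q : ℕ} (hq : ∀ o x, (a.S o x).card ≤ q) (δ' : ℝ) (x : Fin n → A) (o : a.Om) :
    (a.S o x \ a.ker δ').card ≤ q :=
  (Finset.card_le_card Finset.sdiff_subset).trans (hq o x)

lemma G_mass_le (δ δ' : ℝ) (x : Fin n → A) : ∑ _o ∈ a.G δ δ' x, a.w ≤ a.mass x := by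
  unfold mass G
  refine Finset.sum_le_sum_of_subset_of_nonneg ?_ fun _ _ _ => a.w_nonneg
  intro o ho
  rw [Finset.mem_filter] at ho ⊢
  exact ⟨ho.1, ho.2.1⟩

/-- pigeonhole: some level has large mass -/
lemma exists_level {q : ℕ} (hq : ∀ o x, (a.S o x).card ≤ q) (δ : ℕ → ℝ) (hδ : Monotone δ)
    (x : Fin n → A) (τ : ℝ) (h : 2 * τ * (q + 1) ≤ a.mass x) :
    ∃ j ∈ Finset.range (q + 1), 2 * τ ≤ ∑ _o ∈ a.G (δ j) (δ (j + 1)) x, a.w := by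
  by_contra hc
  push Not at hc
  have h1 : a.mass x ≤ ∑ j ∈ Finset.range (q + 1), ∑ _o ∈ a.G (δ j) (δ (j + 1)) x, a.w := by
    unfold mass G
    simp only [Finset.sum_filter]
    rw [Finset.sum_comm]
    refine Finset.sum_le_sum fun o _ => ?_
    have hnn : ∀ j ∈ Finset.range (q + 1), 0 ≤ (if a.acc o x ∧ ∀ v ∈ a.S o x,
        ¬ (δ j < a.deg v ∧ a.deg v ≤ δ (j + 1)) then a.w else 0) := by
      intro j _
      have := a.w_nonneg
      split_ifs <;> simp [this]
    by_cases hacc : a.acc o x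
    · have hj : ∃ j ∈ Finset.range (q + 1), ∀ v ∈ a.S o x,
          ¬ (δ j < a.deg v ∧ a.deg v ≤ δ (j + 1)) := by
        by_contra hno
        push Not at hno
        have : Nonempty (Fin n) := ⟨(hno 0 (by simp)).choose⟩
        choose! f hf using hno
        have hinj : Set.InjOn f (Finset.range (q + 1)) := by
          intro j hj j' hj' hjj
          have h1 := hf j hj
          have h2 := hf j' hj'
          rw [← hjj] at h2
          rcases lt_trichotomy j j' with hl | hl | hl
          · have := hδ (Nat.succ_le_of_lt hl)
            simp only [Nat.succ_eq_add_one] at this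
            linarith [h1.2.2, h2.2.1]
          · exact hl
          · have := hδ (Nat.succ_le_of_lt hl)
            simp only [Nat.succ_eq_add_one] at this
            linarith [h2.2.2, h1.2.1]
        have := Finset.card_le_card_of_injOn f (fun j hj => (hf j hj).1) hinj
        rw [Finset.card_range] at this
        have := hq o x
        omega
      obtain ⟨j, hj, hj2⟩ := hj
      have := Finset.single_le_sum hnn hj
      rw [if_pos ⟨hacc, hj2⟩] at this
      rw [if_pos hacc]
      exact this
    · rw [if_neg hacc]
      exact Finset.sum_nonneg hnn
  have h2 : ∑ j ∈ Finset.range (q + 1), ∑ _o ∈ a.G (δ j) (δ (j + 1)) x, a.w <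
      ∑ j ∈ Finset.range (q + 1), 2 * τ :=
    Finset.sum_lt_sum_of_nonempty ⟨0, by simp⟩ hc
  rw [Finset.sum_const, Finset.card_range, nsmul_eq_mul] at h2
  push_cast at h2
  linarith

lemma vote_local (p δ δ' : ℝ) (Q : Finset (Fin n)) (x y : Fin n → A)
    (h : ∀ v, v ∈ Q ∪ a.ker δ' → x v = y v) : a.vote p δ δ' Q x = a.vote p δ δ' Q y := by
  unfold vote X G
  simp only [Finset.sum_filter]
  refine Finset.sum_congr rfl fun o _ => ?_
  by_cases hx : ∀ v ∈ a.S o x, x v = y v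
  · rw [a.loc_S o x y hx]
    simp only [a.loc_acc o x y hx]
  · have hy : ¬ ∀ v ∈ a.S o y, y v = x v := by
      intro hy
      apply hx
      intro v hv
      rw [← a.loc_S o y x hy] at hy
      exact (hy v hv).symm
    have key : ∀ z : Fin n → A, (∃ v ∈ a.S o z, x v ≠ y v) → ¬ (a.S o z \ a.ker δ' ⊆ Q) := by
      rintro z ⟨v, hv, hne⟩ hs
      apply hne
      apply h
      rw [Finset.mem_union]
      by_cases hk : v ∈ a.ker δ'
      · exact Or.inr hk
      · exact Or.inl (hs (Finset.mem_sdiff.2 ⟨hv, hk⟩))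
    push Not at hx hy
    rw [if_neg (key x hx), if_neg (key y (by
      obtain ⟨v, hv, hne⟩ := hy; exact ⟨v, hv, hne.symm⟩))]
    simp

end LAlg

def ovr {A : Type} {n : ℕ} (K : Finset (Fin n)) (κ : K → A) (x : Fin n → A) : Fin n → A :=
  fun v => if h : v ∈ K then κ ⟨v, h⟩ else x v

/-- deterministic sample-based algorithm -/
noncomputable def detAlg {A : Type} {n : ℕ} (p : ℝ) (h0 : 0 ≤ p) (h1 : p ≤ 1)
    (g : Finset (Fin n) → (Fin n → A) → Prop)
    (hg : ∀ Q x y, (∀ i ∈ Q, x i = y i) → (g Q x ↔ g Q y)) : SampleAlg A n Bool where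
  p := p
  out := fun Q x o => if (o = true ↔ g Q x) then 1 else 0
  p_nonneg := h0
  p_le_one := h1
  out_nonneg := fun Q x o => by split_ifs <;> norm_num
  out_sum := fun Q x => by
    rw [Fintype.sum_bool]
    by_cases h : g Q x <;> simp [h]
  local_out := fun Q x y h => by
    funext o
    simp only [hg Q x y h]

lemma detAlg_true {A : Type} {n : ℕ} (p : ℝ) (h0 : 0 ≤ p) (h1 : p ≤ 1)
    (g : Finset (Fin n) → (Fin n → A) → Prop)
    (hg : ∀ Q x y, (∀ i ∈ Q, x i = y i) → (g Q x ↔ g Q y)) (x : Fin n → A)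
    [∀ Q, Decidable (g Q x)] :
    (detAlg p h0 h1 g hg).pr x (· = true) = bE p (fun Q => if g Q x then 1 else 0) := by
  unfold SampleAlg.pr bE
  refine Finset.sum_congr rfl fun Q _ => ?_
  rw [Fintype.sum_bool]
  simp [detAlg]

lemma detAlg_false {A : Type} {n : ℕ} (p : ℝ) (h0 : 0 ≤ p) (h1 : p ≤ 1)
    (g : Finset (Fin n) → (Fin n → A) → Prop)
    (hg : ∀ Q x y, (∀ i ∈ Q, x i = y i) → (g Q x ↔ g Q y)) (x : Fin n → A)
    [∀ Q, Decidable (g Q x)] :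
    (detAlg p h0 h1 g hg).pr x (· = false) = bE p (fun Q => if g Q x then 0 else 1) := by
  unfold SampleAlg.pr bE
  refine Finset.sum_congr rfl fun Q _ => ?_
  rw [Fintype.sum_bool]
  simp [detAlg]

lemma relDist_tri {A : Type} [DecidableEq A] {n : ℕ} (x y z : Fin n → A) :
    relDist x z ≤ relDist x y + relDist y z := by
  unfold relDist
  rw [← add_div]
  refine div_le_div_of_nonneg_right ?_ (Nat.cast_nonneg _)
  norm_cast
  refine le_trans (Finset.card_le_card ?_) (Finset.card_union_le _ _)
  intro i hi
  simp only [Finset.mem_union, Finset.mem_filter, Finset.mem_univ, true_and] at hi ⊢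
  by_contra hc
  push Not at hc
  exact hi (hc.1.trans hc.2)

lemma relDist_ovr {A : Type} [DecidableEq A] {n : ℕ} (K : Finset (Fin n)) (κ : K → A)
    (x : Fin n → A) : relDist x (ovr K κ x) ≤ (K.card : ℝ) / n := by
  unfold relDist
  refine div_le_div_of_nonneg_right ?_ (Nat.cast_nonneg _)
  norm_cast
  refine Finset.card_le_card ?_
  intro i hi
  simp only [Finset.mem_filter, Finset.mem_univ, true_and] at hi
  by_contra hc
  exact hi (by simp [ovr, hc])

lemma core {A : Type} [Fintype A] [DecidableEq A] {n k : ℕ} (hn : 0 < n) (ε : ℝ)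
    (Ptys : Fin k → Set (Fin n → A)) (a : Fin k → LAlg A n) (p s τ σ : ℝ) (q B : ℕ) (δ : ℕ → ℝ)
    (hp : 0 < p) (hp1 : p ≤ 1) (hs : 10 * (p * n) ≤ s) (hτ : 0 < τ)
    (hδ : ∀ j, 0 < δ j) (hδm : Monotone δ)
    (hq : ∀ i o x, ((a i).S o x).card ≤ q) (hB : ∀ i o, ((a i).U o).card ≤ B)
    (hacc : ∀ i, ∀ x ∈ Ptys i, 1 - σ ≤ (a i).mass x)
    (hfar : ∀ i, ∀ x : Fin n → A, (∀ y ∈ Ptys i, ε / 2 < relDist x y) → (a i).mass x ≤ σ)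
    (hker : ∀ j ≤ q, B / δ (j + 1) ≤ ε / 2 * n)
    (hτσ : 2 * τ * (q + 1) ≤ 1 - σ)
    (hlow : ∀ j ≤ q, δ j * (p ^ q)⁻¹ * (q * 2) ≤ τ / 50)
    (hm : ∀ j ≤ q, ∀ t : ℕ, (t : ℝ) ≤ B / δ (j + 1) → ∃ m : ℕ,
      (k : ℝ) * ((q + 1) * (Fintype.card A ^ t * (1 / 2) ^ m)) ≤ 1 / 3 ∧
        2 * (σ + δ j * (p ^ q)⁻¹ * (q * m)) ≤ τ) :
      ∃ N : SampleAlg A n Bool,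
        (∀ x : (Fin n) → A, x ∈ ⋃ i, Ptys i → 2/3 ≤ N.pr x (· = true)) ∧
        (∀ x : (Fin n) → A, (∀ y : (Fin n) → A, y ∈ ⋃ i, Ptys i → ε < relDist x y) →
          2/3 ≤ N.pr x (· = false)) ∧
        N.complexityLE s := by
  have hn' : (0 : ℝ) < n := by exact_mod_cast hn
  set K : Fin k → ℕ → Finset (Fin n) := fun i j => (a i).ker (δ (j + 1)) with hK
  set V : (i : Fin k) → (j : ℕ) → (K i j → A) → Finset (Fin n) → (Fin n → A) → ℝ :=
    fun i j κ Q x => (a i).vote p (δ j) (δ (j + 1)) Q (ovr (K i j) κ x) with hV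
  set g : Finset (Fin n) → (Fin n → A) → Prop := fun Q x =>
    (Q.card : ℝ) ≤ s ∧ ∃ i, ∃ j ∈ Finset.range (q + 1), ∃ κ : K i j → A, τ ≤ V i j κ Q x with hgd
  have hg : ∀ Q x y, (∀ i ∈ Q, x i = y i) → (g Q x ↔ g Q y) := by
    intro Q x y h
    have : ∀ i j (κ : K i j → A), V i j κ Q x = V i j κ Q y := by
      intro i j κ
      refine LAlg.vote_local _ _ _ _ _ _ _ fun v hv => ?_
      by_cases hk : v ∈ K i j
      · simp [ovr, hk]
      · rw [Finset.mem_union] at hv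
        rcases hv with hv | hv
        · simp [ovr, hk, h v hv]
        · exact absurd hv hk
    simp only [hgd, this]
  refine ⟨detAlg p hp.le hp1 g hg, ?_, ?_, ?_⟩
  · intro x hx
    obtain ⟨i, hi⟩ := Set.mem_iUnion.1 hx
    rw [detAlg_true]
    obtain ⟨j, hj, hjm⟩ := (a i).exists_level (hq i) δ hδm x τ (hτσ.trans (hacc i x hi))
    have hjq : j ≤ q := by simpa [Nat.lt_succ_iff] using hj
    have hx' : ovr (K i j) (fun v => x v) x = x := by
      funext v; simp [ovr]
    have hL := lower ((a i).G (δ j) (δ (j+1)) x) (fun _ => (a i).w)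
      (fun o => (a i).S o x \ (a i).ker (δ (j+1))) p q (δ j) (fun _ => (a i).w_nonneg) hp hp1
      (fun o _ => (a i).petal_card (hq i) _ x o) (hδ j).le
      (fun v => (a i).petal_deg _ _ (hδ j).le x v) τ hτ hjm (hlow j hjq)
    have hC : bE (n := n) p (fun Q => if (Q.card : ℝ) ≤ s then 0 else 1) ≤ 1 / 10 := by
      have : bE (n := n) p (fun Q => (p * n * 10) * (if (Q.card : ℝ) ≤ s then 0 else 1)) ≤
          bE (n := n) p (fun Q => (Q.card : ℝ)) := by
        refine bE_mono hp.le hp1 fun Q => ?_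
        split_ifs with h
        · simp
        · push Not at h
          linarith
      rw [bE_mul, bE_card] at this
      have h0 : 0 < p * n := by positivity
      refine le_of_mul_le_mul_left ?_ h0
      linarith
    have hsum : 1 ≤ bE (n := n) p (fun Q => if g Q x then 1 else 0) +
        (bE (n := n) p (fun Q => if (Q.card : ℝ) ≤ s then 0 else 1) +
        bE (n := n) p (fun Q => if τ ≤ X ((a i).G (δ j) (δ (j+1)) x) (fun _ => (a i).w)
      (fun o => (a i).S o x \ (a i).ker (δ (j+1))) p Q then 0 else 1)) := by
      rw [← bE_add, ← bE_add]
      nth_rewrite 1 [← bE_const (n := n) p 1]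
      refine bE_mono hp.le hp1 fun Q => ?_
      by_cases h1 : (Q.card : ℝ) ≤ s
      · by_cases h2 : τ ≤ X ((a i).G (δ j) (δ (j+1)) x) (fun _ => (a i).w)
          (fun o => (a i).S o x \ (a i).ker (δ (j+1))) p Q
        · have : g Q x := by
            refine ⟨h1, i, j, hj, fun v => x v, ?_⟩
            simp only [hV, hx']
            exact h2
          simp [this, h1, h2]
        · rw [if_neg h2]
          split_ifs <;> norm_num
      · rw [if_neg h1]
        split_ifs <;> norm_num
    linarith
  · intro x hx
    rw [detAlg_false]
    have hone : ∀ i, ∀ j ∈ Finset.range (q + 1),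
        bE (n := n) p (fun Q => ∑ κ : K i j → A, if τ ≤ V i j κ Q x then 1 else 0) ≤
          1 / 3 / (k * (q + 1)) := by
      intro i j hj
      have hjq : j ≤ q := by simpa [Nat.lt_succ_iff] using hj
      have hk0 : (0 : ℝ) < k := by
        have : 0 < k := lt_of_le_of_lt (Nat.zero_le _) i.2
        exact_mod_cast this
      have hKc : ((K i j).card : ℝ) ≤ B / δ (j + 1) := (a i).ker_card (hB i) (hδ _)
      obtain ⟨m, hm1, hm2⟩ := hm j hjq _ hKc
      rw [bE_sum]
      have hb : ∀ κ : K i j → A, bE (n := n) p (fun Q => if τ ≤ V i j κ Q x then 1 else 0) ≤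
          (1 / 2) ^ m := by
        intro κ
        set z := ovr (K i j) κ x with hz
        have hzf : (a i).mass z ≤ σ := by
          apply hfar
          intro y hy
          have h1 := hx y (Set.mem_iUnion.2 ⟨i, hy⟩)
          have h2 := relDist_tri x z y
          have h3 := relDist_ovr (K i j) κ x
          have h4 : ((K i j).card : ℝ) / n ≤ ε / 2 := by
            rw [div_le_iff₀ hn']
            exact hKc.trans (hker j hjq)
          rw [← hz] at h3
          linarith
        refine upper ((a i).G (δ j) (δ (j+1)) z) (fun _ => (a i).w)
          (fun o => (a i).S o z \ (a i).ker (δ (j+1))) p q (δ j) (fun _ => (a i).w_nonneg) hp hp1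
          (fun o _ => (a i).petal_card (hq i) _ z o) (hδ j).le
          (fun v => (a i).petal_deg _ _ (hδ j).le z v) m τ hτ ?_
        have := (a i).G_mass_le (δ j) (δ (j+1)) z
        linarith
      refine (Finset.sum_le_sum fun κ _ => hb κ).trans ?_
      rw [Finset.sum_const, nsmul_eq_mul, Finset.card_univ, Fintype.card_fun, Fintype.card_coe]
      rw [le_div_iff₀ (by positivity)]
      push_cast
      linarith
    have hsum : 1 ≤ bE (n := n) p (fun Q => if g Q x then 0 else 1) +
        bE (n := n) p (fun Q => ∑ i, ∑ j ∈ Finset.range (q + 1), ∑ κ : K i j → A,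
          if τ ≤ V i j κ Q x then 1 else 0) := by
      rw [← bE_add]
      nth_rewrite 1 [← bE_const (n := n) p 1]
      refine bE_mono hp.le hp1 fun Q => ?_
      have hnn3 : ∀ i j, ∀ κ ∈ (Finset.univ : Finset (K i j → A)),
          (0 : ℝ) ≤ if τ ≤ V i j κ Q x then 1 else 0 := by
        intro i j κ _; split_ifs <;> norm_num
      have hnn2 : ∀ i, ∀ j ∈ Finset.range (q + 1), (0 : ℝ) ≤ ∑ κ : K i j → A,
          if τ ≤ V i j κ Q x then 1 else 0 := fun i j _ => Finset.sum_nonneg (hnn3 i j)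
      have hnn1 : ∀ i ∈ (Finset.univ : Finset (Fin k)),
          (0 : ℝ) ≤ ∑ j ∈ Finset.range (q + 1), ∑ κ : K i j → A,
          if τ ≤ V i j κ Q x then 1 else 0 := fun i _ => Finset.sum_nonneg (hnn2 i)
      by_cases hgQ : g Q x
      · obtain ⟨_, i, j, hj, κ, hκ⟩ := hgQ
        have h1 := Finset.single_le_sum (hnn3 i j) (Finset.mem_univ κ)
        have h2 := Finset.single_le_sum (hnn2 i) hj
        have h3 := Finset.single_le_sum hnn1 (Finset.mem_univ i)
        rw [if_pos hκ] at h1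
        have : (0 : ℝ) ≤ if g Q x then 0 else 1 := by split_ifs <;> norm_num
        linarith
      · rw [if_neg hgQ]
        have := Finset.sum_nonneg hnn1
        linarith
    have hle : bE (n := n) p (fun Q => ∑ i, ∑ j ∈ Finset.range (q + 1), ∑ κ : K i j → A,
          if τ ≤ V i j κ Q x then 1 else 0) ≤ 1 / 3 := by
      rw [bE_sum]
      simp_rw [bE_sum p (Finset.range (q + 1))]
      refine (Finset.sum_le_sum fun i _ => Finset.sum_le_sum fun j hj => hone i j hj).trans ?_
      simp only [Finset.sum_const, Finset.card_univ, Finset.card_range, nsmul_eq_mul,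
        Fintype.card_fin]
      push_cast
      rcases Nat.eq_zero_or_pos k with rfl | hk
      · norm_num
      · have : (0 : ℝ) < k := by exact_mod_cast hk
        have : (0 : ℝ) < q + 1 := by positivity
        field_simp
        norm_num
    linarith
  · intro Q hQ x y
    have : ∀ z, ¬ g Q z := fun z hz => absurd hz.1 (not_le.2 hQ)
    funext o
    simp [detAlg, this]

/-! ### Decision trees and amplification -/

noncomputable def allq {A O : Type} [Fintype A] {n : ℕ} : DTree A n O → Finset (Fin n)
  | .leaf _ => ∅
  | .node i ts => insert i (Finset.univ.biUnion fun a => allq (ts a))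

def bb (b : ℕ) : ℕ → ℕ
  | 0 => 0
  | d + 1 => 1 + b * bb b d

lemma bb_mono (b : ℕ) : Monotone (bb b) := by
  refine monotone_nat_of_le_succ fun d => ?_
  induction d with
  | zero => simp [bb]
  | succ d ih =>
    simp only [bb] at ih ⊢
    have := Nat.mul_le_mul_left b ih
    omega

lemma queries_sub {A O : Type} [Fintype A] {n : ℕ} (t : DTree A n O) (x : Fin n → A) :
    t.queries x ⊆ allq t := by
  induction t with
  | leaf o => simp [DTree.queries]
  | node i ts ih =>
    simp only [DTree.queries, allq]
    refine Finset.insert_subset_insert _ ((ih (x i)).trans ?_)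
    exact Finset.subset_biUnion_of_mem (fun a => allq (ts a)) (Finset.mem_univ (x i))

lemma queries_card {A O : Type} [Fintype A] {n : ℕ} (t : DTree A n O) (x : Fin n → A) :
    (t.queries x).card ≤ t.depth := by
  induction t with
  | leaf o => simp [DTree.queries]
  | node i ts ih =>
    simp only [DTree.queries, DTree.depth]
    refine (Finset.card_insert_le _ _).trans ?_
    have h1 := ih (x i)
    have h2 : (ts (x i)).depth ≤ Finset.univ.sup fun a => (ts a).depth :=
      Finset.le_sup (f := fun a => (ts a).depth) (Finset.mem_univ (x i))
    omega

lemma allq_card {A O : Type} [Fintype A] {n : ℕ} (t : DTree A n O) :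
    ∀ d, t.depth ≤ d → (allq t).card ≤ bb (Fintype.card A) d := by
  induction t with
  | leaf o => simp [allq]
  | node i ts ih =>
    intro d hd
    simp only [DTree.depth] at hd
    obtain ⟨d, rfl⟩ : ∃ e, d = e + 1 := ⟨d - 1, by omega⟩
    simp only [allq, bb]
    refine (Finset.card_insert_le _ _).trans ?_
    rw [add_comm]
    refine Nat.add_le_add_left ?_ _
    refine (Finset.card_biUnion_le_card_mul _ _ (bb (Fintype.card A) d) fun a _ => ?_).trans ?_
    · refine ih a d ?_
      have h2 : (ts a).depth ≤ Finset.univ.sup fun a => (ts a).depth :=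
        Finset.le_sup (f := fun a => (ts a).depth) (Finset.mem_univ a)
      omega
    · rw [Finset.card_univ]

lemma queries_loc {A O : Type} {n : ℕ} (t : DTree A n O) (x y : Fin n → A)
    (h : ∀ v ∈ t.queries x, x v = y v) : t.queries y = t.queries x ∧ t.eval y = t.eval x := by
  induction t with
  | leaf o => simp [DTree.queries, DTree.eval]
  | node i ts ih =>
    simp only [DTree.queries, DTree.eval] at h ⊢
    have hi : x i = y i := h i (Finset.mem_insert_self _ _)
    have := ih (x i) fun v hv => h v (Finset.mem_insert_of_mem hv)
    rw [← hi, this.1, this.2]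
    exact ⟨rfl, rfl⟩

noncomputable def amp {A : Type} [Fintype A] {n : ℕ} (T : Multiset (DTree A n Bool)) (hT : T ≠ 0)
    (s : ℕ) : LAlg A n where
  Om := Fin (2 * s) → Fin T.toList.length
  fin := inferInstance
  ne := by
    have : 0 < T.toList.length := by
      rw [Multiset.length_toList]
      exact Multiset.card_pos.2 hT
    exact ⟨fun _ => ⟨0, this⟩⟩
  S := fun o x => Finset.univ.biUnion fun l => (T.toList.get (o l)).queries x
  acc := fun o x => s < (Finset.univ.filter fun l => (T.toList.get (o l)).eval x = true).card
  U := fun o => Finset.univ.biUnion fun l => allq (T.toList.get (o l))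
  S_sub := fun o x => Finset.biUnion_mono fun l _ => queries_sub _ x
  loc_S := fun o x y h => by
    refine Finset.biUnion_congr rfl fun l _ => (queries_loc _ x y fun v hv => h v ?_).1
    exact Finset.mem_biUnion.2 ⟨l, Finset.mem_univ _, hv⟩
  loc_acc := fun o x y h => by
    have : ∀ l, (T.toList.get (o l)).eval y = (T.toList.get (o l)).eval x := by
      intro l
      refine (queries_loc _ x y fun v hv => h v ?_).2
      exact Finset.mem_biUnion.2 ⟨l, Finset.mem_univ _, hv⟩
    simp only [this]

lemma countP_get {α : Type} (T : Multiset α) (P : α → Prop) [DecidablePred P] :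
    Multiset.countP P T =
      (Finset.univ.filter fun i : Fin T.toList.length => P (T.toList.get i)).card := by
  have h : T = Multiset.map T.toList.get (Finset.univ : Finset (Fin T.toList.length)).val := by
    conv_lhs => rw [← Multiset.coe_toList T]
    rw [Fin.univ_def]
    simp
  conv_lhs => rw [h]
  rw [Multiset.countP_map]
  rfl

lemma tup {ι : Type} [Fintype ι] (e : ι → Prop) [DecidablePred e]
    (h : 3 * (Finset.univ.filter e).card ≤ Fintype.card ι) (s : ℕ) :
    ((Finset.univ.filter fun o : Fin (2 * s) → ι =>
      s ≤ (Finset.univ.filter fun l => e (o l)).card).card : ℝ) ≤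
      (8 / 9) ^ s * (Fintype.card ι : ℝ) ^ (2 * s) := by
  have h1 := Fintype.sum_pow (fun i : ι => if e i then (2 : ℝ) else 1) (2 * s)
  have h2 : ∀ o : Fin (2 * s) → ι, ∏ l, (if e (o l) then (2 : ℝ) else 1) =
      2 ^ (Finset.univ.filter fun l => e (o l)).card := by
    intro o
    rw [Finset.prod_ite]
    simp
  simp only [h2] at h1
  have h3 : ∑ i : ι, (if e i then (2 : ℝ) else 1) ≤ 4 / 3 * Fintype.card ι := by
    have : ∀ i : ι, (if e i then (2 : ℝ) else 1) = 1 + if e i then 1 else 0 := by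
      intro i; split_ifs <;> norm_num
    simp only [this]
    rw [Finset.sum_add_distrib, Finset.sum_boole]
    have h' : (3 : ℝ) * (Finset.univ.filter e).card ≤ Fintype.card ι := by exact_mod_cast h
    simp only [Finset.sum_const, Finset.card_univ, nsmul_eq_mul, mul_one]
    linarith
  have h4 : (∑ i : ι, (if e i then (2 : ℝ) else 1)) ^ (2 * s) ≤
      (4 / 3 * Fintype.card ι) ^ (2 * s) := by
    refine pow_le_pow_left₀ (Finset.sum_nonneg fun i _ => ?_) h3 _
    split_ifs <;> norm_num
  rw [h1] at h4
  have h5 : ((Finset.univ.filter fun o : Fin (2 * s) → ι =>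
      s ≤ (Finset.univ.filter fun l => e (o l)).card).card) • (2 : ℝ) ^ s ≤
      ∑ o : Fin (2 * s) → ι, 2 ^ (Finset.univ.filter fun l => e (o l)).card := by
    refine (Finset.card_nsmul_le_sum _ (fun o : Fin (2 * s) → ι =>
      (2 : ℝ) ^ (Finset.univ.filter fun l => e (o l)).card) _ fun o ho => ?_).trans ?_
    · exact pow_le_pow_right₀ (by norm_num) (Finset.mem_filter.1 ho).2
    · exact Finset.sum_le_sum_of_subset_of_nonneg (Finset.subset_univ _) fun _ _ _ => by positivity
  rw [nsmul_eq_mul] at h5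
  have h6 : ((4 : ℝ) / 3 * Fintype.card ι) ^ (2 * s) =
      ((8 / 9) ^ s * (Fintype.card ι : ℝ) ^ (2 * s)) * 2 ^ s := by
    rw [mul_pow, pow_mul (4 / 3 : ℝ), mul_right_comm, ← mul_pow]
    norm_num
  rw [h6] at h4
  exact le_of_mul_le_mul_right (h5.trans h4) (by positivity)

section
variable {A : Type} [Fintype A] {n : ℕ} (T : Multiset (DTree A n Bool)) (hT : T ≠ 0) (s : ℕ)

lemma amp_S {q : ℕ} (hq : ∀ t ∈ T, DTree.depth t ≤ q) (o : (amp T hT s).Om) (x : Fin n → A) :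
    ((amp T hT s).S o x).card ≤ 2 * s * q := by
  refine (Finset.card_biUnion_le_card_mul _ _ q fun l _ => ?_).trans ?_
  · exact (queries_card _ x).trans (hq _ (Multiset.mem_toList.1 (List.get_mem _ _)))
  · simp

lemma amp_U {q : ℕ} (hq : ∀ t ∈ T, DTree.depth t ≤ q) (o : (amp T hT s).Om) :
    ((amp T hT s).U o).card ≤ 2 * s * bb (Fintype.card A) q := by
  refine (Finset.card_biUnion_le_card_mul _ _ (bb (Fintype.card A) q) fun l _ => ?_).trans ?_
  · exact allq_card _ _ (hq _ (Multiset.mem_toList.1 (List.get_mem _ _)))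
  · simp

lemma amp_card : (Fintype.card (amp T hT s).Om : ℝ) = (Fintype.card (Fin T.toList.length) : ℝ) ^ (2 * s) := by
  have : Fintype.card (amp T hT s).Om = Fintype.card (Fin (2 * s) → Fin T.toList.length) := rfl
  rw [this, Fintype.card_fun, Fintype.card_fin]
  push_cast
  simp

lemma amp_w_mul (F : Finset (amp T hT s).Om)
    (h : (F.card : ℝ) ≤ (8 / 9) ^ s * (Fintype.card (Fin T.toList.length) : ℝ) ^ (2 * s)) :
    ∑ _o ∈ F, (amp T hT s).w ≤ (8 / 9) ^ s := by
  rw [Finset.sum_const, nsmul_eq_mul, LAlg.w, mul_one_div, amp_card]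
  have h0 : (0 : ℝ) < (Fintype.card (amp T hT s).Om : ℝ) := by exact_mod_cast Fintype.card_pos
  rw [amp_card] at h0
  rw [div_le_iff₀ h0]
  exact h

lemma err_of_prP (x : Fin n → A) (b : Bool) (h : 2 / 3 ≤ prP T x (· = b)) :
    3 * (Finset.univ.filter fun i : Fin T.toList.length =>
      ¬ (T.toList.get i).eval x = b).card ≤ Fintype.card (Fin T.toList.length) := by
  unfold prP at h
  rw [countP_get] at h
  have hc : (Multiset.card T : ℝ) = (Fintype.card (Fin T.toList.length) : ℝ) := by simp
  rw [hc] at h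
  have h0 : (0 : ℝ) < (Fintype.card (Fin T.toList.length) : ℝ) := by
    by_contra hh
    have : (Fintype.card (Fin T.toList.length) : ℝ) = 0 := le_antisymm (not_lt.1 hh) (by positivity)
    rw [this] at h
    norm_num at h
  rw [le_div_iff₀ h0] at h
  have h2 := Finset.card_filter_add_card_filter_not (s := (Finset.univ : Finset (Fin T.toList.length)))
    (fun i => (T.toList.get i).eval x = b)
  rw [Finset.card_univ] at h2
  have h5 : 2 / 3 * (Fintype.card (Fin T.toList.length) : ℝ) ≤ (Finset.univ.filter fun i :
      Fin T.toList.length => (T.toList.get i).eval x = b).card := by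
    refine h.trans (le_of_eq (congrArg _ (congrArg Finset.card ?_)))
    ext i
    simp
  have h3 : 2 * Fintype.card (Fin T.toList.length) ≤ 3 * (Finset.univ.filter fun i :
      Fin T.toList.length => (T.toList.get i).eval x = b).card := by
    have : (2 : ℝ) * Fintype.card (Fin T.toList.length) ≤ 3 * (Finset.univ.filter fun i :
      Fin T.toList.length => (T.toList.get i).eval x = b).card := by linarith
    exact_mod_cast this
  omega

lemma amp_far (x : Fin n → A) (h : 2 / 3 ≤ prP T x (· = false)) :
    (amp T hT s).mass x ≤ (8 / 9) ^ s := by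
  refine amp_w_mul T hT s _ ?_
  refine le_trans ?_ (tup _ (err_of_prP T x false h) s)
  norm_cast
  refine Finset.card_le_card fun o ho => ?_
  have ho' : s < (Finset.univ.filter fun l => (T.toList.get (o l)).eval x = true).card :=
    (Finset.mem_filter.1 ho).2
  refine Finset.mem_filter.2 ⟨Finset.mem_univ (α := Fin (2 * s) → Fin T.toList.length) o, ?_⟩
  simp only [Bool.not_eq_false]
  exact ho'.le

lemma amp_acc (x : Fin n → A) (h : 2 / 3 ≤ prP T x (· = true)) :
    1 - (8 / 9) ^ s ≤ (amp T hT s).mass x := by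
  have h1 : ∑ o with ¬ (amp T hT s).acc o x, (amp T hT s).w ≤ (8 / 9) ^ s := by
    refine amp_w_mul T hT s _ ?_
    refine le_trans ?_ (tup _ (err_of_prP T x true h) s)
    norm_cast
    refine Finset.card_le_card fun o ho => ?_
    have ho' : ¬ s < (Finset.univ.filter fun l => (T.toList.get (o l)).eval x = true).card :=
      (Finset.mem_filter.1 ho).2
    refine Finset.mem_filter.2 ⟨Finset.mem_univ (α := Fin (2 * s) → Fin T.toList.length) o, ?_⟩
    have h2 := Finset.card_filter_add_card_filter_not (s := (Finset.univ : Finset (Fin (2 * s))))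
      (fun l => (T.toList.get (o l)).eval x = true)
    rw [Finset.card_univ, Fintype.card_fin] at h2
    omega
  have h2 := Finset.sum_filter_add_sum_filter_not (Finset.univ : Finset (amp T hT s).Om)
    (fun o => (amp T hT s).acc o x) (fun _ => (amp T hT s).w)
  have h3 : ∑ _o : (amp T hT s).Om, (amp T hT s).w = 1 := by
    rw [Finset.sum_const, Finset.card_univ, nsmul_eq_mul, LAlg.w]
    have : (Fintype.card (amp T hT s).Om : ℝ) ≠ 0 := by exact_mod_cast Fintype.card_ne_zero
    field_simp
  rw [h3] at h2
  unfold LAlg.mass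
  linarith

end

/-! ### Parameters -/

set_option maxHeartbeats 1000000 in
lemma core2 {A : Type} [Fintype A] [DecidableEq A] {n k : ℕ} (hn : 0 < n) (ε : ℝ) (hε : 0 < ε)
    (Ptys : Fin k → Set (Fin n → A)) (al : Fin k → LAlg A n) (p p0 s σ L γ D : ℝ)
    (q B a e Lk : ℕ)
    (hp0 : 0 < p0) (hp01 : p0 ≤ 1) (hp1 : p ≤ 1) (hL : 1 ≤ L) (hpL : L * p0 ≤ p)
    (hs : 10 * (p * n) ≤ s)
    (hq : ∀ i o x, ((al i).S o x).card ≤ q) (hB : ∀ i o, ((al i).U o).card ≤ B)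
    (hacc : ∀ i, ∀ x ∈ Ptys i, 1 - σ ≤ (al i).mass x)
    (hfar : ∀ i, ∀ x : Fin n → A, (∀ y ∈ Ptys i, ε / 2 < relDist x y) → (al i).mass x ≤ σ)
    (hσ : σ ≤ 1 / (16 * (q + 1))) (hq1 : 1 ≤ q) (hB1 : 1 ≤ B) (ha1 : 1 ≤ a)
    (ha : Fintype.card A ≤ 2 ^ a) (he : 200 ≤ e) (heq : 3 * (q + 1) ≤ 2 ^ e)
    (hk : k ≤ 2 ^ Lk) (hLk : (Lk : ℝ) ≤ 2 * L) (hγ : γ = 1 / (16 * q * (q + 1)))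
    (hD : D = 2 * a * B / γ)
    (H : D ^ q * (2 * B / ε) * (2 * (2 + e) / γ) ≤ n * (p0 ^ q) ^ (q + 1)) :
      ∃ N : SampleAlg A n Bool,
        (∀ x : (Fin n) → A, x ∈ ⋃ i, Ptys i → 2/3 ≤ N.pr x (· = true)) ∧
        (∀ x : (Fin n) → A, (∀ y : (Fin n) → A, y ∈ ⋃ i, Ptys i → ε < relDist x y) →
          2/3 ≤ N.pr x (· = false)) ∧
        N.complexityLE s := by
  have hn' : (0 : ℝ) < n := by exact_mod_cast hn
  have hp : 0 < p := lt_of_lt_of_le (by positivity) hpL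
  have hq1' : (1 : ℝ) ≤ q := by exact_mod_cast hq1
  have hB1' : (1 : ℝ) ≤ B := by exact_mod_cast hB1
  have ha1' : (1 : ℝ) ≤ a := by exact_mod_cast ha1
  have he' : (200 : ℝ) ≤ e := by exact_mod_cast he
  have hγ0 : 0 < γ := by rw [hγ]; positivity
  have hγ1 : γ ≤ 1 := by
    rw [hγ, div_le_one (by positivity)]
    nlinarith
  set u := p0 ^ q with hu
  have hu0 : 0 < u := by positivity
  have hu1 : u ≤ 1 := pow_le_one₀ hp0.le hp01
  have hD1 : 1 ≤ D := by
    rw [hD, le_div_iff₀ hγ0]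
    nlinarith
  have hD0 : 0 < D := by linarith
  set v := (p ^ q)⁻¹ with hv
  have hv0 : 0 < v := by positivity
  -- L * v ≤ u⁻¹
  have hLv : L * v ≤ u⁻¹ := by
    rw [hv, hu, ← div_eq_mul_inv, div_le_iff₀ (by positivity), inv_mul_eq_div,
      le_div_iff₀ (by positivity)]
    calc L * p0 ^ q ≤ L ^ q * p0 ^ q := by
          refine mul_le_mul_of_nonneg_right ?_ (by positivity)
          exact le_self_pow₀ hL (by omega)
      _ = (L * p0) ^ q := by rw [mul_pow]
      _ ≤ p ^ q := pow_le_pow_left₀ (by positivity) hpL _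
  have hvu : v ≤ u⁻¹ := by nlinarith
  set R := u⁻¹ * D with hR
  have hR1 : 1 ≤ R := by
    have : 1 ≤ u⁻¹ := (one_le_inv₀ hu0).2 hu1
    rw [hR]; nlinarith
  have hR0 : 0 < R := by linarith
  set δ : ℕ → ℝ := fun j => 2 * B / (ε * n) * R ^ j with hδd
  have hδ0 : ∀ j, 0 < δ j := fun j => by simp only [hδd]; positivity
  have hδm : Monotone δ := by
    intro i j hij
    simp only [hδd]
    exact mul_le_mul_of_nonneg_left (pow_le_pow_right₀ hR1 hij) (by positivity)
  have hδs : ∀ j, δ (j + 1) = R * δ j := fun j => by simp only [hδd]; ring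
  have hδq : δ q * u⁻¹ * (2 + e) ≤ γ / 2 := by
    have h1 : δ q * u⁻¹ * (2 + e) =
        (D ^ q * (2 * B / ε) * (2 * (2 + e) / γ)) * (γ / 2) / (n * u ^ (q + 1)) := by
      simp only [hδd, hR, mul_pow, inv_pow]
      field_simp
      ring
    rw [h1, div_le_iff₀ (by positivity), mul_comm (γ / 2)]
    exact mul_le_mul_of_nonneg_right H (by positivity)
  have hB2 : ∀ j ≤ q, δ j * v * ((2 + e) * L) ≤ γ / 2 := by
    intro j hj
    refine le_trans ?_ hδq
    calc δ j * v * ((2 + e) * L) = δ j * (2 + e) * (L * v) := by ring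
      _ ≤ δ q * (2 + e) * u⁻¹ := by
          have := hδm hj
          have := hδ0 j
          gcongr
      _ = _ := by ring
  have hγq : γ * q = 1 / (16 * (q + 1)) := by
    rw [hγ]; field_simp
  have hq4 : (1 : ℝ) / (4 * (q + 1)) = 4 * (γ * q) := by
    rw [hγq]; field_simp; norm_num
  refine core hn ε Ptys al p s (1 / (4 * (q + 1))) σ q B δ hp hp1 hs (by positivity) hδ0 hδm hq hB
    hacc hfar ?_ ?_ ?_ ?_
  · intro j _
    rw [div_le_iff₀ (hδ0 _)]
    have h1 := hδm (Nat.zero_le (j + 1))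
    have h2 : ε / 2 * n * δ 0 = B := by
      simp only [hδd]; field_simp
    rw [← h2]
    exact mul_le_mul_of_nonneg_left h1 (by positivity)
  · have h1 : (1 : ℝ) / (16 * (q + 1)) ≤ 1 / 16 := by
      refine one_div_le_one_div_of_le (by norm_num) ?_
      linarith
    have h2 : 2 * (1 / (4 * ((q : ℝ) + 1))) * (q + 1) = 1 / 2 := by field_simp; norm_num
    rw [h2]
    linarith
  · intro j hj
    have h1 := hB2 j hj
    have h2 : δ j * v * 202 ≤ γ / 2 := by
      refine le_trans (mul_le_mul_of_nonneg_left ?_ ?_) h1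
      · nlinarith
      · have := hδ0 j; positivity
    rw [hq4]
    have h3 := mul_le_mul_of_nonneg_right h2 (by positivity : (0 : ℝ) ≤ q)
    have h4 : 0 ≤ γ * q := by positivity
    linarith
  · intro j hj t ht
    refine ⟨a * t + Lk + e, ?_, ?_⟩
    · have h1 : (k : ℝ) ≤ 2 ^ Lk := by exact_mod_cast hk
      have h2 : (Fintype.card A : ℝ) ^ t ≤ 2 ^ (a * t) := by
        rw [pow_mul]
        exact pow_le_pow_left₀ (by positivity) (by exact_mod_cast ha) _
      have h3 : (3 : ℝ) * (q + 1) ≤ 2 ^ e := by exact_mod_cast heq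
      calc (k : ℝ) * ((q + 1) * (Fintype.card A ^ t * (1 / 2) ^ (a * t + Lk + e)))
          ≤ 2 ^ Lk * ((q + 1) * (2 ^ (a * t) * (1 / 2) ^ (a * t + Lk + e))) := by gcongr
        _ = (q + 1) * (1 / 2) ^ e := by
            rw [pow_add, pow_add, one_div, inv_pow, inv_pow, inv_pow]
            field_simp
        _ ≤ 1 / 3 := by
            rw [one_div, inv_pow, ← div_eq_mul_inv, div_le_iff₀ (by positivity)]
            linarith
    · have h1 : δ j * v * (a * (B / δ (j + 1))) ≤ γ / 2 := by
        have e1 : δ j * v * (a * (B / δ (j + 1))) = (v * u) * (γ / 2) := by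
          have := hδ0 j
          have := hδ0 (j + 1)
          rw [hδs, hR, hD]
          field_simp
        rw [e1]
        have : v * u ≤ 1 := by
          have := mul_le_mul_of_nonneg_right hvu hu0.le
          rwa [inv_mul_cancel₀ hu0.ne'] at this
        nlinarith
      have h2 := hB2 j hj
      have h3 : ((a * t + Lk + e : ℕ) : ℝ) ≤ a * (B / δ (j + 1)) + (2 + e) * L := by
        push_cast
        have := mul_le_mul_of_nonneg_left ht (by positivity : (0 : ℝ) ≤ a)
        have h6 : (e : ℝ) * 1 ≤ e * L := mul_le_mul_of_nonneg_left hL (by positivity)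
        linarith
      have h0 : 0 ≤ δ j * v := by have := hδ0 j; positivity
      have h4 : δ j * v * ((a * t + Lk + e : ℕ) : ℝ) ≤ γ := by
        have := mul_le_mul_of_nonneg_left h3 h0
        linarith
      have h5 := mul_le_mul_of_nonneg_right h4 (by positivity : (0 : ℝ) ≤ q)
      rw [hq4]
      rw [← hγq] at hσ
      linarith

lemma fullRead {A : Type} [DecidableEq A] {n k : ℕ} (ε : ℝ) (hε : 0 < ε)
    (Ptys : Fin k → Set (Fin n → A)) (s : ℝ) (hs : (n : ℝ) ≤ s) :
      ∃ N : SampleAlg A n Bool,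
        (∀ x : (Fin n) → A, x ∈ ⋃ i, Ptys i → 2/3 ≤ N.pr x (· = true)) ∧
        (∀ x : (Fin n) → A, (∀ y : (Fin n) → A, y ∈ ⋃ i, Ptys i → ε < relDist x y) →
          2/3 ≤ N.pr x (· = false)) ∧
        N.complexityLE s := by
  have hE : ∀ f : Finset (Fin n) → ℝ, bE 1 f = f Finset.univ := by
    intro f
    unfold bE
    rw [Finset.sum_eq_single Finset.univ]
    · simp
    · intro Q _ hQ
      have : Q.card < n := by
        have hex : ∃ v, v ∉ Q := by
          by_contra hc
          push Not at hc
          exact hQ (Finset.eq_univ_iff_forall.2 hc)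
        obtain ⟨v, hv⟩ := hex
        have := Finset.card_lt_univ_of_notMem hv
        simpa using this
      have h : n - Q.card ≠ 0 := by omega
      simp [h]
    · simp
  refine ⟨detAlg 1 zero_le_one le_rfl (fun Q x => Q = Finset.univ ∧ x ∈ ⋃ i, Ptys i) ?_,
    ?_, ?_, ?_⟩
  · intro Q x y h
    constructor
    · rintro ⟨rfl, hx⟩
      have : x = y := funext fun i => h i (Finset.mem_univ _)
      exact ⟨rfl, this ▸ hx⟩
    · rintro ⟨rfl, hx⟩
      have : x = y := funext fun i => h i (Finset.mem_univ _)
      exact ⟨rfl, this ▸ hx⟩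
  · intro x hx
    rw [detAlg_true, hE, if_pos ⟨rfl, hx⟩]
    norm_num
  · intro x hx
    rw [detAlg_false, hE, if_neg]
    · norm_num
    · rintro ⟨_, hh⟩
      have := hx x hh
      simp [relDist] at this
      linarith
  · intro Q hQ
    exfalso
    have : Q.card ≤ n := by simpa using Finset.card_le_univ Q
    have : (Q.card : ℝ) ≤ n := by exact_mod_cast this
    linarith

lemma emptyCase {A : Type} [DecidableEq A] {n : ℕ} (ε : ℝ)
    (Ptys : Fin 0 → Set (Fin n → A)) (s : ℝ) :
      ∃ N : SampleAlg A n Bool,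
        (∀ x : (Fin n) → A, x ∈ ⋃ i, Ptys i → 2/3 ≤ N.pr x (· = true)) ∧
        (∀ x : (Fin n) → A, (∀ y : (Fin n) → A, y ∈ ⋃ i, Ptys i → ε < relDist x y) →
          2/3 ≤ N.pr x (· = false)) ∧
        N.complexityLE s := by
  refine ⟨detAlg 0 le_rfl zero_le_one (fun _ _ => False) (fun _ _ _ _ => Iff.rfl), ?_, ?_, ?_⟩
  · intro x hx
    simp at hx
  · intro x _
    rw [detAlg_false]
    simp only [if_false, bE_const]
    norm_num
  · intro Q _ x y
    rfl

lemma amp_param (q : ℕ) :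
    ((8 : ℝ) / 9) ^ (84 * Nat.clog 2 (q + 2)) ≤
      1 / (16 * (((2 * (84 * Nat.clog 2 (q + 2)) * q : ℕ) : ℝ) + 1)) := by
  set l := Nat.clog 2 (q + 2) with hl
  have h1 : q + 2 ≤ 2 ^ l := Nat.le_pow_clog (by norm_num) _
  have hl1 : 1 ≤ l := Nat.clog_pos (by norm_num) (by omega)
  have h2 : l ≤ 2 ^ l := Nat.lt_two_pow_self.le
  have h3 : ((8 : ℝ) / 9) ^ (84 * l) ≤ (1 / 2) ^ (14 * l) := by
    rw [pow_mul, pow_mul]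
    refine pow_le_pow_left₀ (by positivity) ?_ _
    norm_num
  refine h3.trans ?_
  rw [one_div, inv_pow, ← one_div]
  refine one_div_le_one_div_of_le (by positivity) ?_
  have h4 : 16 * (2 * (84 * l) * q + 1) ≤ 2 ^ (14 * l) := by
    have h5 : l * (q + 2) ≤ 2 ^ l * 2 ^ l := Nat.mul_le_mul h2 h1
    have h6 : 2 ^ (14 * l) = 2 ^ l * 2 ^ l * (2 ^ 12) ^ l := by
      rw [← pow_mul, ← pow_add, ← pow_add]
      congr 1
      ring
    have h7 : 2 ^ 12 ≤ (2 ^ 12) ^ l := Nat.le_self_pow (by omega) _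
    rw [h6]
    calc 16 * (2 * (84 * l) * q + 1) ≤ (l * (q + 2)) * 2 ^ 12 := by nlinarith
      _ ≤ _ := Nat.mul_le_mul h5 h7
  exact_mod_cast h4

lemma clog_le (m : ℕ) (hm : 2 ≤ m) : (Nat.clog 2 m : ℝ) ≤ 2 * Real.logb 2 m := by
  have h1 : 1 ≤ Nat.clog 2 m := Nat.clog_pos (by norm_num) (by omega)
  have h2 : 2 ^ (Nat.clog 2 m - 1) < m := by
    have := Nat.pow_pred_clog_lt_self (b := 2) (by norm_num) (x := m) (by omega)
    simpa using this
  have hm' : (2 : ℝ) ≤ m := by exact_mod_cast hm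
  have h3 : ((Nat.clog 2 m - 1 : ℕ) : ℝ) ≤ Real.logb 2 m := by
    rw [Real.le_logb_iff_rpow_le (by norm_num) (by linarith), Real.rpow_natCast]
    exact_mod_cast h2.le
  have h4 : 1 ≤ Real.logb 2 m := by
    rw [Real.le_logb_iff_rpow_le (by norm_num) (by linarith)]
    simpa using hm'
  rw [Nat.cast_sub h1] at h3
  push_cast at h3
  linarith

end UT

/-- **Sample-based multi-testing.** There is a universal constant `c > 0` such that for
every finite alphabet `Σ`, every `ε > 0` and every `q`, there is a threshold `n₀` such
that for all `n ≥ n₀`: if `Pty = Pty₁ ∪ ⋯ ∪ Pty_k ⊆ Σⁿ` where each `Pty_i` admits an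
`(ε/2)`-tester with `q` queries and error rate `1/3`, then `Pty` admits a sample-based
`ε`-tester with error rate `1/3` and sample complexity at most
`c·log₂(k+1)·n^(1 - 1/(c·q²·log₂²(q+2)))`. -/
theorem union_tester_to_sample_based :
    ∃ c : ℝ, 0 < c ∧
    ∀ (A : Type) [Fintype A] [DecidableEq A] (ε : ℝ), 0 < ε →
    ∀ q : ℕ, ∃ n₀ : ℕ, ∀ n : ℕ, n₀ ≤ n →
    ∀ (k : ℕ) (Ptys : Fin k → Set ((Fin n) → A))
      (T : Fin k → Multiset (DTree A n Bool)),
      (∀ i, T i ≠ 0) →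
      (∀ i, ∀ t ∈ T i, DTree.depth t ≤ q) →
      (∀ i, ∀ x ∈ Ptys i, 2/3 ≤ prP (T i) x (· = true)) →
      (∀ i, ∀ x : (Fin n) → A, (∀ y ∈ Ptys i, ε / 2 < relDist x y) →
        2/3 ≤ prP (T i) x (· = false)) →
      ∃ N : SampleAlg A n Bool,
        (∀ x : (Fin n) → A, x ∈ ⋃ i, Ptys i → 2/3 ≤ N.pr x (· = true)) ∧
        (∀ x : (Fin n) → A, (∀ y : (Fin n) → A, y ∈ ⋃ i, Ptys i → ε < relDist x y) →
          2/3 ≤ N.pr x (· = false)) ∧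
        N.complexityLE
          (c * Real.logb 2 ((k : ℝ) + 1) *
            (n : ℝ) ^ (1 - 1 / (c * (q : ℝ) ^ 2 * (Real.logb 2 ((q : ℝ) + 2)) ^ 2))) := by
  refine ⟨1000000, by norm_num, ?_⟩
  intro A _ _ ε hε q
  rcases Nat.eq_zero_or_pos q with hq0 | hq1
  · subst hq0
    refine ⟨0, ?_⟩
    intro n _ k Ptys T _ _ _ _
    rcases Nat.eq_zero_or_pos k with hk | hk
    · subst hk
      exact UT.emptyCase ε Ptys _
    · refine UT.fullRead ε hε Ptys _ ?_
      have hL : 1 ≤ Real.logb 2 ((k : ℝ) + 1) := by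
        have hk' : (1 : ℝ) ≤ k := by exact_mod_cast hk
        rw [Real.le_logb_iff_rpow_le (by norm_num) (by linarith)]
        norm_num
        linarith
      have hn0 : (0 : ℝ) ≤ n := by positivity
      simp only [Nat.cast_zero, ne_eq, OfNat.ofNat_ne_zero, not_false_eq_true, zero_pow, mul_zero,
        zero_mul, div_zero, sub_zero, Real.rpow_one]
      nlinarith
  -- main case
  set l := Nat.clog 2 (q + 2) with hl
  have hl1 : 1 ≤ l := Nat.clog_pos (by norm_num) (by omega)
  set sA := 84 * l with hsA
  set q' := 2 * sA * q with hq'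
  have hq'1 : 1 ≤ q' := Nat.one_le_iff_ne_zero.2 (by positivity)
  set B := 2 * sA * UT.bb (Fintype.card A) q + 1 with hB
  set a := Fintype.card A + 1 with ha
  set e := 200 + 3 * (q' + 1) with he
  set γ : ℝ := 1 / (16 * q' * (q' + 1)) with hγ
  set D : ℝ := 2 * a * B / γ with hD
  set Cst : ℝ := D ^ q' * (2 * B / ε) * (2 * (2 + e) / γ) with hCst
  have hCst0 : 0 ≤ Cst := by positivity
  refine ⟨⌈Cst ^ 2⌉₊ + 1, ?_⟩
  intro n hn k Ptys T hT hdepth hacc hfar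
  rcases Nat.eq_zero_or_pos k with hk | hk
  · subst hk
    exact UT.emptyCase ε Ptys _
  have hn0 : 0 < n := by omega
  have hn1 : (1 : ℝ) ≤ n := by exact_mod_cast hn0
  have hnC : Cst ^ 2 ≤ n := by
    refine (Nat.le_ceil _).trans ?_
    have : ⌈Cst ^ 2⌉₊ ≤ n := by omega
    exact_mod_cast this
  set L := Real.logb 2 ((k : ℝ) + 1) with hLd
  have hL : 1 ≤ L := by
    have hk' : (1 : ℝ) ≤ k := by exact_mod_cast hk
    rw [hLd, Real.le_logb_iff_rpow_le (by norm_num) (by linarith)]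
    norm_num
    linarith
  set lg := Real.logb 2 ((q : ℝ) + 2) with hlg
  have hl2 : (l : ℝ) ≤ 2 * lg := by
    have := UT.clog_le (q + 2) (by omega)
    push_cast at this
    exact this
  have hl1' : (1 : ℝ) ≤ l := by exact_mod_cast hl1
  have hlg0 : 0 < lg := by linarith
  have hq1' : (1 : ℝ) ≤ q := by exact_mod_cast hq1
  set θ : ℝ := 1 / (1000000 * (q : ℝ) ^ 2 * lg ^ 2) with hθ
  have hθ0 : 0 < θ := by positivity
  set p0 : ℝ := (n : ℝ) ^ (-θ) with hp0
  have hnpos : (0 : ℝ) < n := by linarith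
  have hs : (n : ℝ) ^ (1 - θ) = n * p0 := by
    rw [sub_eq_add_neg, Real.rpow_add hnpos, Real.rpow_one]
  rw [hs]
  by_cases hbig : (n : ℝ) ≤ 1000000 * L * (n * p0)
  · exact UT.fullRead ε hε Ptys _ hbig
  push Not at hbig
  have hp00 : 0 < p0 := by positivity
  have hp01 : p0 ≤ 1 := Real.rpow_le_one_of_one_le_of_nonpos hn1 (by linarith)
  have hsmall : 1000000 * L * p0 < 1 := by
    by_contra hc
    push Not at hc
    nlinarith
  refine UT.core2 hn0 ε hε Ptys (fun i => UT.amp (T i) (hT i) sA) (100000 * L * p0) p0 _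
    ((8 / 9) ^ sA) L γ D q' B a e (Nat.clog 2 (k + 1)) hp00 hp01 ?_ hL ?_ ?_ ?_ ?_ ?_ ?_ ?_ hq'1 ?_ ?_ ?_ ?_
    ?_ ?_ ?_ hγ hD ?_
  · linarith
  · have : 0 < L * p0 := by positivity
    linarith
  · exact le_of_eq (by ring)
  · intro i o x
    exact UT.amp_S (T i) (hT i) sA (hdepth i) o x
  · intro i o
    exact (UT.amp_U (T i) (hT i) sA (hdepth i) o).trans (Nat.le_succ _)
  · intro i x hx
    exact UT.amp_acc (T i) (hT i) sA x (hacc i x hx)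
  · intro i x hx
    exact UT.amp_far (T i) (hT i) sA x (hfar i x hx)
  · exact UT.amp_param q
  · omega
  · omega
  · have : Fintype.card A < 2 ^ Fintype.card A := Nat.lt_two_pow_self
    rw [ha, pow_succ]
    omega
  · omega
  · rw [he]
    refine Nat.lt_two_pow_self.le.trans (Nat.pow_le_pow_right (by norm_num) ?_)
    omega
  · exact (Nat.le_succ k).trans (Nat.le_pow_clog (by norm_num) _)
  · have := UT.clog_le (k + 1) (by omega)
    push_cast at this
    exact this
  · rw [← hCst]
    have e1 : (p0 ^ q') ^ (q' + 1) = (n : ℝ) ^ (-(θ * (q' * (q' + 1)))) := by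
      rw [← pow_mul, ← Real.rpow_natCast, hp0, ← Real.rpow_mul hnpos.le]
      congr 1
      push_cast
      ring
    have hq'c : (q' : ℝ) = 2 * (84 * l) * q := by
      rw [hq', hsA]; push_cast; ring
    have hq'2 : (q' : ℝ) ≤ 336 * (q * lg) := by
      rw [hq'c]
      nlinarith
    have hq'1r : (1 : ℝ) ≤ q' := by exact_mod_cast hq'1
    have e2 : θ * (q' * (q' + 1)) ≤ 1 / 2 := by
      have h1 : (q' : ℝ) * (q' + 1) ≤ 2 * (q' : ℝ) ^ 2 := by nlinarith
      have h2 : (q' : ℝ) ^ 2 ≤ (336 * (q * lg)) ^ 2 := pow_le_pow_left₀ (by positivity) hq'2 _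
      rw [hθ, one_div, inv_mul_eq_div, div_le_iff₀ (by positivity)]
      have h3 : 0 ≤ ((q : ℝ) * lg) ^ 2 := by positivity
      nlinarith
    rw [e1]
    have e3 : (n : ℝ) * (n : ℝ) ^ (-(θ * (q' * (q' + 1)))) =
        (n : ℝ) ^ (1 - θ * (q' * (q' + 1))) := by
      rw [sub_eq_add_neg, Real.rpow_add hnpos, Real.rpow_one]
    rw [e3]
    calc Cst ≤ Real.sqrt n := Real.le_sqrt_of_sq_le hnC
      _ = (n : ℝ) ^ ((1 : ℝ) / 2) := Real.sqrt_eq_rpow _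
      _ ≤ _ := Real.rpow_le_rpow_of_exponent_le hn1 (by linarith)
end

section
/- For every ρ > 0 there exist a constant c > 0 and, for each ℓ ∈ ℕ and finite alphabet Σ, a threshold n₀ such that for all n ≥ n₀ the following holds. Let M be a (ρ_0, ρ_1)-robust relaxed local algorithm with query complexity ℓ computing a partial function f : Σ^n ⇀ {0,1} with error rate 1/3, valid input set V ⊆ Σ^n, and ρ_0, ρ_1 ≥ ρ. Then there exists a sample-based relaxed local algorithm N for f with the same valid input set V, error rate 1/3, and sample complexity at most n^{1 − 1/(c·ℓ²·log₂²(ℓ+2))}. -/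
open scoped Classical

/-! ### Expectation over a binomial random subset -/

/-- Expectation of `G Q` for a `p`-random subset `Q` of `s`. -/
noncomputable def bE {n : ℕ} (p : ℝ) (s : Finset (Fin n)) (G : Finset (Fin n) → ℝ) : ℝ :=
  ∑ Q ∈ s.powerset, p ^ Q.card * (1 - p) ^ (s.card - Q.card) * G Q

lemma bE_empty {n : ℕ} (p : ℝ) (G : Finset (Fin n) → ℝ) : bE p ∅ G = G ∅ := by
  simp [bE]

lemma bE_insert {n : ℕ} (p : ℝ) (s : Finset (Fin n)) (j : Fin n) (hj : j ∉ s)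
    (G : Finset (Fin n) → ℝ) :
    bE p (insert j s) G = bE p s (fun Q => p * G (insert j Q) + (1 - p) * G Q) := by
  unfold bE
  rw [Finset.sum_powerset_insert hj, ← Finset.sum_add_distrib]
  refine Finset.sum_congr rfl fun Q hQ => ?_
  have hQs : Q ⊆ s := Finset.mem_powerset.1 hQ
  have hjQ : j ∉ Q := fun h => hj (hQs h)
  have hc := Finset.card_le_card hQs
  rw [Finset.card_insert_of_notMem hj, Finset.card_insert_of_notMem hjQ]
  have h1 : s.card + 1 - Q.card = (s.card - Q.card) + 1 := by omega
  have h2 : s.card + 1 - (Q.card + 1) = s.card - Q.card := by omega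
  rw [h1, h2, pow_succ, pow_succ]
  ring

lemma bE_congr {n : ℕ} (p : ℝ) (s : Finset (Fin n)) {G H : Finset (Fin n) → ℝ}
    (h : ∀ Q, Q ⊆ s → G Q = H Q) : bE p s G = bE p s H := by
  unfold bE
  refine Finset.sum_congr rfl fun Q hQ => ?_
  rw [h Q (Finset.mem_powerset.1 hQ)]

lemma bE_mono {n : ℕ} {p : ℝ} (h0 : 0 ≤ p) (h1 : p ≤ 1) (s : Finset (Fin n))
    {G H : Finset (Fin n) → ℝ} (h : ∀ Q, G Q ≤ H Q) : bE p s G ≤ bE p s H := by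
  unfold bE
  refine Finset.sum_le_sum fun Q _ => ?_
  have : 0 ≤ 1 - p := by linarith
  exact mul_le_mul_of_nonneg_left (h Q) (by positivity)

lemma bE_mul {n : ℕ} (p : ℝ) (s : Finset (Fin n)) (c : ℝ) (G : Finset (Fin n) → ℝ) :
    bE p s (fun Q => c * G Q) = c * bE p s G := by
  unfold bE
  rw [Finset.mul_sum]
  exact Finset.sum_congr rfl fun Q _ => by ring

lemma bE_add {n : ℕ} (p : ℝ) (s : Finset (Fin n)) (G H : Finset (Fin n) → ℝ) :
    bE p s (fun Q => G Q + H Q) = bE p s G + bE p s H := by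
  unfold bE
  rw [← Finset.sum_add_distrib]
  exact Finset.sum_congr rfl fun Q _ => by ring

lemma bE_sum {n : ℕ} {ι : Type*} (p : ℝ) (s : Finset (Fin n)) (T : Finset ι)
    (G : ι → Finset (Fin n) → ℝ) :
    bE p s (fun Q => ∑ i ∈ T, G i Q) = ∑ i ∈ T, bE p s (G i) := by
  unfold bE
  rw [Finset.sum_comm]
  exact Finset.sum_congr rfl fun Q _ => by rw [Finset.mul_sum]

lemma bE_one {n : ℕ} (p : ℝ) (s : Finset (Fin n)) : bE p s (fun _ => 1) = 1 := by
  induction s using Finset.induction_on with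
  | empty => simp [bE_empty]
  | insert j s hj ih =>
    rw [bE_insert p s j hj]
    simpa using ih

lemma bE_subset {n : ℕ} (p : ℝ) (s : Finset (Fin n)) : ∀ P : Finset (Fin n), P ⊆ s →
    bE p s (fun Q => if P ⊆ Q then 1 else 0) = p ^ P.card := by
  induction s using Finset.induction_on with
  | empty =>
    intro P hP
    have : P = ∅ := Finset.subset_empty.1 hP
    subst this
    simp [bE_empty]
  | insert j s hj ih =>
    intro P hP
    rw [bE_insert p s j hj]
    by_cases hjP : j ∈ P
    · have h1 : P.erase j ⊆ s := by
        intro k hk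
        rcases Finset.mem_insert.1 (hP (Finset.mem_of_mem_erase hk)) with h | h
        · exact absurd h (Finset.ne_of_mem_erase hk)
        · exact h
      rw [← Finset.card_erase_add_one hjP, pow_succ, ← ih _ h1, mul_comm, ← bE_mul]
      refine bE_congr p s fun Q hQ => ?_
      have h2 : ¬ P ⊆ Q := fun h => hj (hQ (h hjP))
      have h3 : P ⊆ insert j Q ↔ P.erase j ⊆ Q := Finset.subset_insert_iff
      simp [h2, h3]
    · have h1 : P ⊆ s := (Finset.subset_insert_iff_of_notMem hjP).1 hP
      rw [← ih _ h1]
      refine bE_congr p s fun Q hQ => ?_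
      have h3 : P ⊆ insert j Q ↔ P ⊆ Q := Finset.subset_insert_iff_of_notMem hjP
      simp only [h3]
      split_ifs <;> ring

lemma bE_card {n : ℕ} (p : ℝ) :
    bE p (Finset.univ : Finset (Fin n)) (fun Q => (Q.card : ℝ)) = p * n := by
  have h : (fun Q : Finset (Fin n) => (Q.card : ℝ)) =
      fun Q => ∑ j ∈ (Finset.univ : Finset (Fin n)), if {j} ⊆ Q then (1 : ℝ) else 0 := by
    funext Q
    simp
  rw [h, bE_sum]
  simp_rw [bE_subset p Finset.univ _ (Finset.subset_univ _)]
  simp [mul_comm]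

lemma two_point (p : ℝ) (h0 : 0 ≤ p) (h1 : p ≤ 1) (u v c : ℝ) (h : |u - v| ≤ c) :
    p * Real.exp u + (1 - p) * Real.exp v ≤ Real.exp (p * u + (1 - p) * v + c ^ 2 / 2) := by
  set m := p * u + (1 - p) * v with hm
  have hA : p * Real.exp u + (1 - p) * Real.exp v =
      Real.exp m * (p * Real.exp (u - m) + (1 - p) * Real.exp (v - m)) := by
    rw [Real.exp_sub, Real.exp_sub]
    field_simp
  rw [hA, Real.exp_add m]
  refine mul_le_mul_of_nonneg_left ?_ (Real.exp_pos _).le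
  have hq : 0 ≤ 1 - p := by linarith
  have hB : 1 ≤ p * Real.exp (m - u) + (1 - p) * Real.exp (m - v) := by
    have a1 := mul_le_mul_of_nonneg_left (Real.add_one_le_exp (m - u)) h0
    have a2 := mul_le_mul_of_nonneg_left (Real.add_one_le_exp (m - v)) hq
    have : p * (m - u + 1) + (1 - p) * (m - v + 1) = 1 := by rw [hm]; ring
    linarith
  have hpos : 0 ≤ p * Real.exp (u - m) + (1 - p) * Real.exp (v - m) := by positivity
  have hC : (p * Real.exp (u - m) + (1 - p) * Real.exp (v - m)) *
      (p * Real.exp (m - u) + (1 - p) * Real.exp (m - v)) =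
      1 + 2 * (p * (1 - p)) * (Real.cosh (u - v) - 1) := by
    have e1 : Real.exp (u - m) * Real.exp (m - u) = 1 := by
      rw [← Real.exp_add]; simp
    have e2 : Real.exp (v - m) * Real.exp (m - v) = 1 := by
      rw [← Real.exp_add]; simp
    have e3 : Real.exp (u - m) * Real.exp (m - v) = Real.exp (u - v) := by
      rw [← Real.exp_add]; congr 1; ring
    have e4 : Real.exp (v - m) * Real.exp (m - u) = Real.exp (-(u - v)) := by
      rw [← Real.exp_add]; congr 1; ring
    rw [Real.cosh_eq]
    linear_combination p ^ 2 * e1 + (1 - p) ^ 2 * e2 + p * (1 - p) * e3 + p * (1 - p) * e4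
  have hch : 1 ≤ Real.cosh (u - v) := Real.one_le_cosh _
  have hch2 := Real.cosh_le_exp_half_sq (u - v)
  have hpq : 2 * (p * (1 - p)) ≤ 1 := by nlinarith [sq_nonneg (2 * p - 1)]
  have hsq : (u - v) ^ 2 / 2 ≤ c ^ 2 / 2 := by
    have := sq_le_sq' (by linarith [neg_le_of_abs_le h]) (le_of_abs_le h)
    linarith
  calc _ ≤ _ := le_mul_of_one_le_right hpos hB
    _ = _ := hC
    _ ≤ Real.cosh (u - v) := by nlinarith
    _ ≤ _ := hch2
    _ ≤ _ := Real.exp_le_exp.2 hsq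

/-- Bounded differences: moment generating function. -/
lemma bE_exp {n : ℕ} (p : ℝ) (h0 : 0 ≤ p) (h1 : p ≤ 1) (c : Fin n → ℝ) (s : Finset (Fin n)) :
    ∀ G : Finset (Fin n) → ℝ, (∀ j ∈ s, ∀ Q, |G (insert j Q) - G Q| ≤ c j) →
    bE p s (fun Q => Real.exp (G Q)) ≤ Real.exp (bE p s G + (∑ j ∈ s, c j ^ 2) / 2) := by
  induction s using Finset.induction_on with
  | empty => intro G _; simp [bE_empty]
  | insert j s hj ih =>
    intro G hG
    have hq : 0 ≤ 1 - p := by linarith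
    rw [bE_insert p s j hj, bE_insert p s j hj, Finset.sum_insert hj]
    have hI := ih (fun Q => p * G (insert j Q) + (1 - p) * G Q) (by
      intro k hk Q
      have a1 := hG k (Finset.mem_insert_of_mem hk) (insert j Q)
      have a2 := hG k (Finset.mem_insert_of_mem hk) Q
      rw [Finset.insert_comm] at a1
      rw [abs_le] at a1 a2 ⊢
      constructor <;> nlinarith)
    calc _ ≤ bE p s (fun Q => Real.exp (c j ^ 2 / 2) *
          Real.exp (p * G (insert j Q) + (1 - p) * G Q)) := by
          refine bE_mono h0 h1 s fun Q => ?_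
          rw [← Real.exp_add, add_comm (c j ^ 2 / 2)]
          exact two_point p h0 h1 _ _ _ (hG j (Finset.mem_insert_self _ _) Q)
      _ ≤ _ := by
          rw [bE_mul]
          refine (mul_le_mul_of_nonneg_left hI (Real.exp_pos _).le).trans ?_
          rw [← Real.exp_add]
          apply le_of_eq
          congr 1
          ring

/-- Bounded differences: tail bound. -/
lemma bE_tail {n : ℕ} (p : ℝ) (h0 : 0 ≤ p) (h1 : p ≤ 1) (c : Fin n → ℝ)
    (G : Finset (Fin n) → ℝ) (hG : ∀ j Q, |G (insert j Q) - G Q| ≤ c j)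
    (S : ℝ) (hS : 0 < S) (hcS : ∑ j, c j ^ 2 ≤ S) (ε : ℝ) (hε : 0 < ε)
    (E : ℝ) (hE : bE p Finset.univ G ≤ E) :
    bE p Finset.univ (fun Q => if E + ε ≤ G Q then 1 else 0) ≤ Real.exp (-(ε ^ 2 / (2 * S))) := by
  set lam := ε / S with hl
  have hlpos : 0 < lam := by positivity
  have hX := bE_exp p h0 h1 (fun j => lam * c j) Finset.univ (fun Q => lam * G Q) (by
    intro j _ Q
    rw [← mul_sub, abs_mul, abs_of_pos hlpos]
    exact mul_le_mul_of_nonneg_left (hG j Q) hlpos.le)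
  rw [bE_mul] at hX
  calc _ ≤ bE p Finset.univ (fun Q => Real.exp (-(lam * (E + ε))) * Real.exp (lam * G Q)) := by
        refine bE_mono h0 h1 _ fun Q => ?_
        rw [← Real.exp_add]
        split_ifs with h
        · apply Real.one_le_exp
          nlinarith
        · positivity
    _ ≤ _ := by
        rw [bE_mul]
        refine (mul_le_mul_of_nonneg_left hX (Real.exp_pos _).le).trans ?_
        rw [← Real.exp_add]
        apply Real.exp_le_exp.2
        have e1 : ∑ j, (lam * c j) ^ 2 = lam ^ 2 * ∑ j, c j ^ 2 := by
          rw [Finset.mul_sum]; exact Finset.sum_congr rfl fun j _ => by ring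
        rw [e1]
        have e2 : lam ^ 2 * ∑ j, c j ^ 2 ≤ lam ^ 2 * S := by gcongr
        have e3 : lam * bE p Finset.univ G ≤ lam * E := by gcongr
        have e4 : -(ε ^ 2 / (2 * S)) = lam ^ 2 * S / 2 - lam * ε := by
          rw [hl]; field_simp; ring
        rw [e4]
        nlinarith

/-! ### Concentration of the petal-counting estimator -/

/-- The estimator: total (normalised) weight of good petals contained in the sample. -/
noncomputable def est {n : ℕ} {ι : Type} [Fintype ι] (p w : ℝ) (P : ι → Finset (Fin n))
    (g : ι → Prop) (Q : Finset (Fin n)) : ℝ :=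
  ∑ t, if g t ∧ P t ⊆ Q then w * p⁻¹ ^ (P t).card else 0

lemma bE_est {n : ℕ} {ι : Type} [Fintype ι] (p w : ℝ) (hp : 0 < p) (P : ι → Finset (Fin n))
    (g : ι → Prop) :
    bE p Finset.univ (est p w P g) = ∑ t, if g t then w else 0 := by
  unfold est
  rw [bE_sum]
  refine Finset.sum_congr rfl fun t _ => ?_
  by_cases hg : g t
  · simp only [hg, true_and, if_true]
    have : (fun Q : Finset (Fin n) => if P t ⊆ Q then w * p⁻¹ ^ (P t).card else 0) =
        fun Q => (w * p⁻¹ ^ (P t).card) * (if P t ⊆ Q then 1 else 0) := by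
      funext Q; split_ifs <;> simp
    rw [this, bE_mul, bE_subset p _ _ (Finset.subset_univ _), mul_assoc, ← mul_pow,
      inv_mul_cancel₀ hp.ne', one_pow, mul_one]
  · simp only [hg, false_and, if_false]
    have := bE_mul p (Finset.univ : Finset (Fin n)) 0 (fun _ => 1)
    simpa using this

lemma est_diff {n : ℕ} {ι : Type} [Fintype ι] (p w : ℝ) (hp : 0 < p) (hp1 : p ≤ 1) (hw : 0 ≤ w)
    (P : ι → Finset (Fin n)) (g : ι → Prop) (q : ℕ) (hPq : ∀ t, (P t).card ≤ q)
    (j : Fin n) (Q : Finset (Fin n)) :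
    |est p w P g (insert j Q) - est p w P g Q| ≤
      p⁻¹ ^ q * ∑ t, if g t ∧ j ∈ P t then w else 0 := by
  unfold est
  rw [← Finset.sum_sub_distrib, Finset.mul_sum]
  refine (Finset.abs_sum_le_sum_abs _ _).trans (Finset.sum_le_sum fun t _ => ?_)
  have hinv : 1 ≤ p⁻¹ := (one_le_inv₀ hp).2 hp1
  have hpw : p⁻¹ ^ (P t).card ≤ p⁻¹ ^ q := pow_le_pow_right₀ hinv (hPq t)
  have hpp : 0 ≤ p⁻¹ ^ (P t).card := by positivity
  by_cases hg : g t
  · by_cases hj : j ∈ P t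
    · simp only [hg, hj, true_and, and_self, if_true]
      have hle : w * p⁻¹ ^ (P t).card ≤ p⁻¹ ^ q * w := by
        rw [mul_comm]; gcongr
      have hnn : 0 ≤ w * p⁻¹ ^ (P t).card := by positivity
      rw [abs_le]
      split_ifs <;> constructor <;> linarith
    · have h3 : P t ⊆ insert j Q ↔ P t ⊆ Q := Finset.subset_insert_iff_of_notMem hj
      simp [h3, hj]
  · simp [hg]

lemma est_tails {n : ℕ} {ι : Type} [Fintype ι] (p w : ℝ) (hp : 0 < p) (hp1 : p ≤ 1) (hw : 0 ≤ w)
    (P : ι → Finset (Fin n)) (g : ι → Prop) (q : ℕ) (hPq : ∀ t, (P t).card ≤ q)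
    (δ : Fin n → ℝ) (hδ0 : ∀ j, 0 ≤ δ j) (B : ℝ) (hB : 0 < B) (hδ : ∑ j, δ j ≤ B)
    (lo : ℝ) (hlo : 0 < lo) (hgl : ∀ t, g t → ∀ j ∈ P t, δ j ≤ lo)
    (hdeg : ∀ j, (∑ t, if g t ∧ j ∈ P t then w else 0) ≤ δ j)
    (ε : ℝ) (hε : 0 < ε) (S : ℝ) (hS : S = (p⁻¹ ^ q) ^ 2 * lo * B) :
    (∀ E, (∑ t, if g t then w else 0) ≤ E →
      bE p Finset.univ (fun Q => if E + ε ≤ est p w P g Q then 1 else 0) ≤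
        Real.exp (-(ε ^ 2 / (2 * S)))) ∧
    (∀ E, E ≤ (∑ t, if g t then w else 0) →
      bE p Finset.univ (fun Q => if est p w P g Q ≤ E - ε then 1 else 0) ≤
        Real.exp (-(ε ^ 2 / (2 * S)))) := by
  set c : Fin n → ℝ := fun j => if δ j ≤ lo then p⁻¹ ^ q * δ j else 0 with hc
  have hpq : 0 < p⁻¹ ^ q := by positivity
  have hdiff : ∀ j Q, |est p w P g (insert j Q) - est p w P g Q| ≤ c j := by
    intro j Q
    refine (est_diff p w hp hp1 hw P g q hPq j Q).trans ?_
    simp only [hc]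
    split_ifs with h
    · exact mul_le_mul_of_nonneg_left (hdeg j) hpq.le
    · have : ∀ t, ¬ (g t ∧ j ∈ P t) := fun t ht => h (hgl t ht.1 j ht.2)
      simp [this]
  have hsum : ∑ j, c j ^ 2 ≤ S := by
    have h1 : ∀ j, c j ^ 2 ≤ (p⁻¹ ^ q) ^ 2 * lo * δ j := by
      intro j
      simp only [hc]
      split_ifs with h
      · have := mul_le_mul_of_nonneg_right h (hδ0 j)
        have h2 := mul_le_mul_of_nonneg_left this (sq_nonneg (p⁻¹ ^ q))
        calc _ = (p⁻¹ ^ q) ^ 2 * (δ j * δ j) := by ring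
          _ ≤ _ := h2
          _ = _ := by ring
      · have := hδ0 j
        have h3 : 0 ≤ (p⁻¹ ^ q) ^ 2 * lo * δ j := by positivity
        simpa using h3
    refine (Finset.sum_le_sum fun j _ => h1 j).trans ?_
    rw [← Finset.mul_sum, hS]
    gcongr
  have hSpos : 0 < S := by rw [hS]; positivity
  constructor
  · intro E hE
    exact bE_tail p hp.le hp1 c _ hdiff S hSpos hsum ε hε E (by rwa [bE_est p w hp])
  · intro E hE
    have := bE_tail p hp.le hp1 c (fun Q => -1 * est p w P g Q) (by
      intro j Q
      have := hdiff j Q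
      rw [abs_le] at this ⊢
      constructor <;> linarith) S hSpos hsum ε hε (-E) (by
      rw [bE_mul, bE_est p w hp]; linarith)
    refine le_trans (le_of_eq ?_) this
    congr 1
    funext Q
    congr 1
    apply propext
    constructor <;> intro h <;> linarith

/-! ### Decision trees -/

namespace DTree

/-- All coordinates appearing in a tree. -/
def supp {A O : Type} [Fintype A] {n : ℕ} : DTree A n O → Finset (Fin n)
  | leaf _ => ∅
  | node i ts => insert i (Finset.univ.biUnion fun a => (ts a).supp)

/-- Bound on the number of coordinates appearing in a tree. -/
def bd (a : ℕ) : ℕ → ℕ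
  | 0 => 0
  | d + 1 => a * bd a d + 1

lemma supp_card {A O : Type} [Fintype A] {n : ℕ} (d : ℕ) :
    ∀ t : DTree A n O, t.depth ≤ d → t.supp.card ≤ bd (Fintype.card A) d := by
  induction d with
  | zero =>
    intro t ht
    cases t with
    | leaf b => simp [supp]
    | node i ts => simp [depth] at ht
  | succ d ih =>
    intro t ht
    cases t with
    | leaf b => simp [supp]
    | node i ts =>
      simp only [depth] at ht
      have h1 : ∀ a, (ts a).depth ≤ d := by
        intro a
        have := Finset.le_sup (f := fun a => (ts a).depth) (Finset.mem_univ a)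
        omega
      simp only [supp, bd]
      refine (Finset.card_insert_le _ _).trans (Nat.succ_le_succ ?_)
      exact Finset.card_biUnion_le_card_mul _ _ _ fun a _ => ih _ (h1 a)

lemma queries_subset {A O : Type} [Fintype A] {n : ℕ} (t : DTree A n O) (x : Fin n → A) :
    t.queries x ⊆ t.supp := by
  induction t with
  | leaf b => simp [queries]
  | node i ts ih =>
    simp only [queries, supp]
    refine Finset.insert_subset_insert _ ((ih (x i)).trans ?_)
    exact Finset.subset_biUnion_of_mem (fun a => (ts a).supp) (Finset.mem_univ (x i))

lemma queries_card {A O : Type} [Fintype A] {n : ℕ} (t : DTree A n O) (x : Fin n → A) :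
    (t.queries x).card ≤ t.depth := by
  induction t with
  | leaf b => simp [queries]
  | node i ts ih =>
    simp only [queries, depth]
    have := Finset.le_sup (f := fun a => (ts a).depth) (Finset.mem_univ (x i))
    have h2 := Finset.card_insert_le i ((ts (x i)).queries x)
    have h3 := ih (x i)
    omega

lemma agree {A O : Type} {n : ℕ} (t : DTree A n O) (x y : Fin n → A)
    (h : ∀ i ∈ t.queries x, x i = y i) : t.queries x = t.queries y ∧ t.eval x = t.eval y := by
  induction t with
  | leaf b => simp [queries, eval]
  | node i ts ih =>
    have hi : x i = y i := h i (by simp [queries])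
    have := ih (x i) (fun k hk => h k (by simp [queries, hk]))
    simp only [queries, eval]
    rw [this.1, this.2, hi]
    exact ⟨rfl, rfl⟩

end DTree

/-! ### The sample-based algorithm -/

/-- Overwrite `x` on the kernel `K` by `κ`. -/
def ovr {A : Type} {n : ℕ} (K : Finset (Fin n)) (κ : K → A) (x : Fin n → A) : Fin n → A :=
  fun j => if h : j ∈ K then κ ⟨j, h⟩ else x j

lemma ovr_self {A : Type} {n : ℕ} (K : Finset (Fin n)) (x : Fin n → A) :
    ovr K (fun j => x j) x = x := by
  funext j
  simp [ovr]

/-- The petal of tree `t`. -/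
def pet {A : Type} {n : ℕ} {ι : Type} (T : ι → DTree A n (Option Bool))
    (K : Finset (Fin n)) (κ : K → A) (x : Fin n → A) (t : ι) : Finset (Fin n) :=
  (T t).queries (ovr K κ x) \ K

/-- Tree `t` outputs `b` and its petal only has low-degree coordinates. -/
def gd {A : Type} {n : ℕ} {ι : Type} (T : ι → DTree A n (Option Bool)) (δ : Fin n → ℝ) (lo : ℝ)
    (b : Bool) (K : Finset (Fin n)) (κ : K → A) (x : Fin n → A) (t : ι) : Prop :=
  (T t).eval (ovr K κ x) = some b ∧ ∀ j ∈ pet T K κ x t, δ j ≤ lo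

lemma gd_local_aux {A : Type} {n : ℕ} {ι : Type} (T : ι → DTree A n (Option Bool))
    (K : Finset (Fin n)) (κ : K → A) (x y : Fin n → A) (t : ι) (Q : Finset (Fin n))
    (hxy : ∀ i ∈ Q, x i = y i) (h : pet T K κ x t ⊆ Q) :
    (T t).queries (ovr K κ x) = (T t).queries (ovr K κ y) ∧
    (T t).eval (ovr K κ x) = (T t).eval (ovr K κ y) := by
  apply DTree.agree
  intro i hi
  unfold ovr
  split_ifs with hK
  · rfl
  · exact hxy i (h (Finset.mem_sdiff.2 ⟨hi, hK⟩))

lemma est_local {A : Type} {n : ℕ} {ι : Type} [Fintype ι] (T : ι → DTree A n (Option Bool))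
    (δ : Fin n → ℝ) (lo : ℝ) (b : Bool) (p w : ℝ)
    (K : Finset (Fin n)) (κ : K → A) (x y : Fin n → A) (Q : Finset (Fin n))
    (hxy : ∀ i ∈ Q, x i = y i) :
    est p w (pet T K κ x) (gd T δ lo b K κ x) Q = est p w (pet T K κ y) (gd T δ lo b K κ y) Q := by
  unfold est
  refine Finset.sum_congr rfl fun t _ => ?_
  by_cases h : pet T K κ x t ⊆ Q
  · obtain ⟨h1, h2⟩ := gd_local_aux T K κ x y t Q hxy h
    simp only [gd, pet, h1, h2]
    congr
  · by_cases h' : pet T K κ y t ⊆ Q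
    · obtain ⟨h1, h2⟩ := gd_local_aux T K κ y x t Q (fun i hi => (hxy i hi).symm) h'
      simp only [gd, pet, h1, h2]
      congr
    · simp [h, h']

/-- Deterministic sample-based algorithm from a decision function. -/
noncomputable def mkAlg {A : Type} {n : ℕ} (p : ℝ) (h0 : 0 ≤ p) (h1 : p ≤ 1)
    (dec : Finset (Fin n) → (Fin n → A) → Option Bool)
    (hloc : ∀ Q x y, (∀ i ∈ Q, x i = y i) → dec Q x = dec Q y) : SampleAlg A n (Option Bool) where
  p := p
  out Q x o := if o = dec Q x then 1 else 0
  p_nonneg := h0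
  p_le_one := h1
  out_nonneg Q x o := by split_ifs <;> norm_num
  out_sum Q x := by simp
  local_out Q x y h := by rw [hloc Q x y h]

lemma mkAlg_pr {A : Type} {n : ℕ} (p : ℝ) (h0 : 0 ≤ p) (h1 : p ≤ 1)
    (dec : Finset (Fin n) → (Fin n → A) → Option Bool)
    (hloc : ∀ Q x y, (∀ i ∈ Q, x i = y i) → dec Q x = dec Q y) (x : Fin n → A)
    (P : Option Bool → Prop) :
    (mkAlg p h0 h1 dec hloc).pr x P = bE p Finset.univ (fun Q => if P (dec Q x) then 1 else 0) := by
  unfold SampleAlg.pr bE mkAlg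
  simp only [Finset.powerset_univ, Finset.card_univ, Fintype.card_fin]
  refine Finset.sum_congr rfl fun Q _ => ?_
  congr 1
  rw [Finset.sum_eq_single (dec Q x)]
  · simp
  · intro o _ ho
    simp [ho]
  · simp

/-- Markov bound on the sample size. -/
lemma bE_markov {n : ℕ} (p : ℝ) (h0 : 0 ≤ p) (h1 : p ≤ 1) (s : ℝ) (hs : 0 < s) :
    bE p (Finset.univ : Finset (Fin n)) (fun Q => if s < (Q.card : ℝ) then 1 else 0) ≤ p * n / s := by
  rw [← bE_card, div_eq_inv_mul, ← bE_mul]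
  refine bE_mono h0 h1 _ fun Q => ?_
  split_ifs with h
  · rw [← div_eq_inv_mul, le_div_iff₀ hs]
    linarith
  · positivity

theorem core {A : Type} [Fintype A] [DecidableEq A] (q : ℕ) (hq : 1 ≤ q) (L : ℕ) (hL : L = 12 * q)
    (n : ℕ) (ρ B W : ℝ) (hρ : 0 < ρ) (hB : 1 ≤ B) (hBd : (DTree.bd (Fintype.card A) q : ℝ) ≤ B)
    (hn : W ^ (8 * q * L) = n) (hW9 : 9 ≤ W) (hWρ : B / ρ ≤ W)
    (hWB : 128 * B * ((Fintype.card A) * B + 9 * L) ≤ W)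
    {ι : Type} [Fintype ι] [Nonempty ι] (T : ι → DTree A n (Option Bool))
    (hT : ∀ t, (T t).depth ≤ q) (w : ℝ) (hw : w = ((Fintype.card ι : ℕ) : ℝ)⁻¹)
    (dom V : Set (Fin n → A)) (f : (Fin n → A) → Bool) (hVd : V ⊆ dom)
    (hV : ∀ x ∈ V, 2 / 3 ≤ ∑ t, if (T t).eval x = some (f x) then w else 0)
    (hR : ∀ x ∈ dom, ∀ y, relDist y x ≤ ρ →
      (∑ t, if (T t).eval y = some (!f x) then w else 0) ≤ 1 / 3) :
    ∃ N : SampleAlg A n (Option Bool),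
        (∀ x ∈ V, 2/3 ≤ N.pr x (· = some (f x))) ∧
        (∀ x ∈ dom, 2/3 ≤ N.pr x (fun o => o = some (f x) ∨ o = none)) ∧
        N.complexityLE (n / W) := by
  have hWpos : 0 < W := by linarith
  have hnpos : (0 : ℝ) < n := by rw [← hn]; positivity
  have hLpos : 0 < L := by omega
  have hwpos : 0 < w := by rw [hw]; positivity
  set p : ℝ := (W ^ 2)⁻¹ with hp
  have hp0 : 0 < p := by positivity
  have hp1 : p ≤ 1 := by
    rw [hp]; apply inv_le_one_of_one_le₀; nlinarith
  set δ : Fin n → ℝ := fun j => ∑ t, if j ∈ (T t).supp then w else 0 with hδ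
  have hδ0 : ∀ j, 0 ≤ δ j := fun j => Finset.sum_nonneg fun t _ => by split_ifs <;> positivity
  have hδB : ∑ j, δ j ≤ B := by
    simp only [hδ]
    rw [Finset.sum_comm]
    have h1 : ∀ t, (∑ j, if j ∈ (T t).supp then w else 0) ≤ w * B := by
      intro t
      rw [← Finset.sum_filter]
      simp only [Finset.sum_const, Finset.filter_univ_mem, nsmul_eq_mul]
      rw [mul_comm]
      have : ((T t).supp.card : ℝ) ≤ DTree.bd (Fintype.card A) q := by
        exact_mod_cast DTree.supp_card q _ (hT t)
      gcongr
      linarith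
    refine (Finset.sum_le_sum fun t _ => h1 t).trans ?_
    simp only [Finset.sum_const, Finset.card_univ, nsmul_eq_mul]
    rw [hw, ← mul_assoc, mul_inv_cancel₀ (by positivity), one_mul]
  set θ : ℕ → ℝ := fun i => (W ^ (8 * q)) ^ i / n with hθ
  have hθpos : ∀ i, 0 < θ i := fun i => by simp only [hθ]; positivity
  set K : ℕ → Finset (Fin n) := fun i => Finset.univ.filter (fun j => θ (i + 1) < δ j) with hK
  have hKcard : ∀ i, ((K i).card : ℝ) ≤ B * (θ (i + 1))⁻¹ := by
    intro i
    rw [← div_eq_mul_inv, le_div_iff₀ (hθpos _)]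
    calc ((K i).card : ℝ) * θ (i + 1) = ∑ j ∈ K i, θ (i + 1) := by simp
      _ ≤ ∑ j ∈ K i, δ j := Finset.sum_le_sum fun j hj => by
          simp only [hK, Finset.mem_filter] at hj; exact hj.2.le
      _ ≤ ∑ j, δ j := Finset.sum_le_univ_sum_of_nonneg hδ0
      _ ≤ B := hδB
  have hW1 : 1 ≤ W := by linarith
  -- robustness
  have hdist : ∀ i (κ : K i → A) (x : Fin n → A), relDist (ovr (K i) κ x) x ≤ ρ := by
    intro i κ x
    unfold relDist
    rw [div_le_iff₀ hnpos]
    have h1 : (Finset.univ.filter fun j => ovr (K i) κ x j ≠ x j).card ≤ (K i).card := by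
      apply Finset.card_le_card
      intro j hj
      by_contra hjK
      simp [ovr, hjK] at hj
    have h2 : ((Finset.univ.filter fun j => ovr (K i) κ x j ≠ x j).card : ℝ) ≤ (K i).card := by
      exact_mod_cast h1
    refine h2.trans ((hKcard i).trans ?_)
    have h3 : B / ρ ≤ (W ^ (8 * q)) ^ (i + 1) := by
      refine hWρ.trans ?_
      rw [← pow_mul]
      exact le_self_pow₀ hW1 (by positivity)
    rw [div_le_iff₀ hρ] at h3
    simp only [hθ]
    rw [inv_div, mul_div_assoc', div_le_iff₀ (by positivity)]
    nlinarith
  -- tails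
  set tl : ℕ → ℝ := fun i => Real.exp (-(W ^ (4 * q) * (θ (i + 1))⁻¹ / (128 * B))) with htl
  have htails : ∀ i (κ : K i → A) (x : Fin n → A) (b : Bool),
    (∀ E, (∑ t, if gd T δ (θ i) b (K i) κ x t then w else 0) ≤ E →
      bE p Finset.univ (fun Q => if E + 1 / 8 ≤
        est p w (pet T (K i) κ x) (gd T δ (θ i) b (K i) κ x) Q then 1 else 0) ≤ tl i) ∧
    (∀ E, E ≤ (∑ t, if gd T δ (θ i) b (K i) κ x t then w else 0) →
      bE p Finset.univ (fun Q => if est p w (pet T (K i) κ x) (gd T δ (θ i) b (K i) κ x) Q ≤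
        E - 1 / 8 then 1 else 0) ≤ tl i) := by
    intro i κ x b
    have hpq : ∀ t, (pet T (K i) κ x t).card ≤ q := fun t =>
      (Finset.card_le_card Finset.sdiff_subset).trans ((DTree.queries_card _ _).trans (hT t))
    have key := est_tails p w hp0 hp1 hwpos.le (pet T (K i) κ x) (gd T δ (θ i) b (K i) κ x) q hpq
      δ hδ0 B (by linarith) hδB (θ i) (hθpos i) (fun t ht => ht.2) (by
        intro j
        refine Finset.sum_le_sum fun t _ => ?_
        by_cases h : j ∈ (T t).supp
        · simp only [h, if_true]; split_ifs <;> linarith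
        · have : ¬ (gd T δ (θ i) b (K i) κ x t ∧ j ∈ pet T (K i) κ x t) := fun hh =>
            h (DTree.queries_subset _ _ (Finset.mem_sdiff.1 hh.2).1)
          simp [h, this]) (1 / 8) (by norm_num) _ rfl
    have e : Real.exp (-((1 / 8 : ℝ) ^ 2 / (2 * ((p⁻¹ ^ q) ^ 2 * θ i * B)))) = tl i := by
      simp only [htl, hθ, hp]
      congr 2
      rw [inv_inv]
      have : (W ^ (8 * q)) ^ (i + 1) = (W ^ (8 * q)) ^ i * (W ^ (4 * q)) ^ 2 := by ring
      rw [this]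
      have h4 : ((W ^ 2) ^ q) ^ 2 = W ^ (4 * q) := by ring
      rw [h4]
      field_simp
      norm_num
    rw [e] at key
    exact key
  -- numeric bounds
  have hnum : ∀ i < L, (Fintype.card A : ℝ) ^ (K i).card * tl i ≤ 1 / (9 * L) := by
    intro i hi
    have hY : 1 ≤ (θ (i + 1))⁻¹ := by
      simp only [hθ]
      rw [inv_div, one_le_div (by positivity), ← hn, ← pow_mul]
      exact pow_le_pow_right₀ hW1 (Nat.mul_le_mul_left _ hi)
    have hTW : W ≤ W ^ (4 * q) := le_self_pow₀ hW1 (by positivity)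
    have h1 : (Fintype.card A : ℝ) ^ (K i).card ≤
        Real.exp ((Fintype.card A : ℝ) * B * (θ (i + 1))⁻¹) := by
      have : (Fintype.card A : ℝ) ≤ Real.exp (Fintype.card A : ℝ) := by
        linarith [Real.add_one_le_exp (Fintype.card A : ℝ)]
      calc _ ≤ Real.exp (Fintype.card A : ℝ) ^ (K i).card := by gcongr
        _ = Real.exp ((K i).card * (Fintype.card A : ℝ)) := by rw [Real.exp_nat_mul]
        _ ≤ _ := by
          apply Real.exp_le_exp.2
          have := hKcard i
          have := mul_le_mul_of_nonneg_left this (Nat.cast_nonneg (α := ℝ) (Fintype.card A))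
          linarith
    have hBpos : 0 < B := by linarith
    have hLr : (1 : ℝ) ≤ L := by exact_mod_cast hLpos
    calc _ ≤ Real.exp ((Fintype.card A : ℝ) * B * (θ (i + 1))⁻¹) * tl i := by
          gcongr
      _ = Real.exp (-((θ (i + 1))⁻¹ * (W ^ (4 * q) / (128 * B) - (Fintype.card A : ℝ) * B))) := by
          simp only [htl]
          rw [← Real.exp_add]
          congr 1
          ring
      _ ≤ Real.exp (-(9 * L)) := by
          apply Real.exp_le_exp.2
          have h5 : (Fintype.card A : ℝ) * B + 9 * L ≤ W ^ (4 * q) / (128 * B) := by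
            rw [le_div_iff₀ (by positivity)]
            linarith
          have h6 : (9 : ℝ) * L ≤ W ^ (4 * q) / (128 * B) - (Fintype.card A : ℝ) * B := by linarith
          have h7 : (0:ℝ) ≤ 9 * L := by positivity
          nlinarith
      _ ≤ _ := by
          rw [Real.exp_neg, one_div]
          apply inv_anti₀ (by positivity)
          linarith [Real.add_one_le_exp (9 * (L : ℝ))]
  -- the algorithm
  set fires : Bool → Finset (Fin n) → (Fin n → A) → Prop := fun b Q x =>
    ∃ i : Fin L, ∃ κ : K i → A,
      11 / 24 ≤ est p w (pet T (K i) κ x) (gd T δ (θ i) b (K i) κ x) Q with hfires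
  have hfloc : ∀ b Q x y, (∀ i ∈ Q, x i = y i) → fires b Q x = fires b Q y := by
    intro b Q x y h
    simp only [hfires]
    apply propext
    refine exists_congr fun i => exists_congr fun κ => ?_
    rw [est_local T δ (θ i) b p w (K i) κ x y Q h]
  set s : ℝ := n / W with hs
  have hspos : 0 < s := by positivity
  set dec : Finset (Fin n) → (Fin n → A) → Option Bool := fun Q x =>
    if s < (Q.card : ℝ) then none
    else if fires true Q x ∧ ¬ fires false Q x then some true
    else if fires false Q x ∧ ¬ fires true Q x then some false
    else none with hdec
  have hwrong : ∀ x ∈ dom, bE p Finset.univ (fun Q => if fires (!f x) Q x then 1 else 0) ≤ 1 / 9 := by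
    intro x hx
    have h1 : ∀ i : Fin L, ∀ κ : K i → A, bE p Finset.univ (fun Q => if 11 / 24 ≤
        est p w (pet T (K i) κ x) (gd T δ (θ i) (!f x) (K i) κ x) Q then 1 else 0) ≤ tl i := by
      intro i κ
      have h2 := (htails i κ x (!f x)).1 (1 / 3) (by
        refine le_trans (Finset.sum_le_sum fun t _ => ?_) (hR x hx _ (hdist i κ x))
        by_cases h : gd T δ (θ i) (!f x) (K i) κ x t
        · have := h.1
          simp [h, this]
        · simp only [h, if_false]; split_ifs <;> linarith)
      norm_num at h2 ⊢
      exact h2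
    calc _ ≤ bE p Finset.univ (fun Q => ∑ i : Fin L, ∑ κ : K i → A, if 11 / 24 ≤
        est p w (pet T (K i) κ x) (gd T δ (θ i) (!f x) (K i) κ x) Q then (1 : ℝ) else 0) := by
          refine bE_mono hp0.le hp1 _ fun Q => ?_
          have nn : ∀ (i : Fin L) (κ : K i → A), (0 : ℝ) ≤ if 11 / 24 ≤
            est p w (pet T (K i) κ x) (gd T δ (θ i) (!f x) (K i) κ x) Q then (1 : ℝ) else 0 :=
            fun i κ => by split_ifs <;> norm_num
          split_ifs with h
          · obtain ⟨i, κ, hik⟩ := h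
            refine le_trans ?_ (Finset.single_le_sum
              (fun i _ => Finset.sum_nonneg fun κ _ => nn i κ) (Finset.mem_univ i))
            refine le_trans ?_ (Finset.single_le_sum (fun κ _ => nn i κ) (Finset.mem_univ κ))
            simp [hik]
          · exact Finset.sum_nonneg fun i _ => Finset.sum_nonneg fun κ _ => nn i κ
      _ = ∑ i : Fin L, ∑ κ : K i → A, bE p Finset.univ (fun Q => if 11 / 24 ≤
        est p w (pet T (K i) κ x) (gd T δ (θ i) (!f x) (K i) κ x) Q then (1 : ℝ) else 0) := by
          rw [bE_sum]
          exact Finset.sum_congr rfl fun i _ => by rw [bE_sum]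
      _ ≤ ∑ i : Fin L, ∑ κ : K i → A, tl i :=
          Finset.sum_le_sum fun i _ => Finset.sum_le_sum fun κ _ => h1 i κ
      _ ≤ ∑ i : Fin L, 1 / (9 * (L : ℝ)) := by
          refine Finset.sum_le_sum fun i _ => ?_
          have := hnum i i.2
          simpa using this
      _ = 1 / 9 := by
          have : (L : ℝ) ≠ 0 := by positivity
          simp
          field_simp
  have hright : ∀ x ∈ V, bE p Finset.univ (fun Q => if ¬ fires (f x) Q x then 1 else 0) ≤ 1 / 9 := by
    intro x hx
    -- find a good gap
    have hex : ∃ i : Fin L, (∑ t, if (∃ j ∈ (T t).queries x, θ i < δ j ∧ δ j ≤ θ (i + 1))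
        then w else 0) ≤ 1 / 12 := by
      by_contra hcon
      push Not at hcon
      have h1 : ∑ i : Fin L, (1 / 12 : ℝ) < ∑ i : Fin L, ∑ t,
          if (∃ j ∈ (T t).queries x, θ i < δ j ∧ δ j ≤ θ (i + 1)) then w else 0 :=
        Finset.sum_lt_sum_of_nonempty ⟨⟨0, hLpos⟩, Finset.mem_univ _⟩ fun i _ => hcon i
      rw [Finset.sum_comm] at h1
      have h2 : ∀ t, (∑ i : Fin L,
          if (∃ j ∈ (T t).queries x, θ i < δ j ∧ δ j ≤ θ (i + 1)) then w else 0) ≤ q * w := by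
        intro t
        have hmono : Monotone θ := by
          intro i j hij
          simp only [hθ]
          have : 1 ≤ W ^ (8 * q) := one_le_pow₀ hW1
          gcongr
        have h3 : ∀ j, (∑ i : Fin L, if (θ i < δ j ∧ δ j ≤ θ (i + 1)) then w else 0) ≤ w := by
          intro j
          rw [← Finset.sum_filter, Finset.sum_const, nsmul_eq_mul]
          have : (Finset.univ.filter fun i : Fin L => θ i < δ j ∧ δ j ≤ θ (i + 1)).card ≤ 1 := by
            rw [Finset.card_le_one]
            intro a ha b hb
            simp only [Finset.mem_filter, Finset.mem_univ, true_and] at ha hb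
            by_contra hab
            rcases lt_or_gt_of_ne hab with h | h
            · have := hmono (show (a : ℕ) + 1 ≤ b from h)
              linarith [ha.2, hb.1]
            · have := hmono (show (b : ℕ) + 1 ≤ a from h)
              linarith [hb.2, ha.1]
          have : ((Finset.univ.filter fun i : Fin L => θ i < δ j ∧ δ j ≤ θ (i + 1)).card : ℝ) ≤ 1 := by
            exact_mod_cast this
          nlinarith
        calc _ ≤ ∑ i : Fin L, ∑ j ∈ (T t).queries x,
              if (θ i < δ j ∧ δ j ≤ θ (i + 1)) then w else 0 := by
              refine Finset.sum_le_sum fun i _ => ?_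
              have nn : ∀ j ∈ (T t).queries x,
                  (0 : ℝ) ≤ if (θ i < δ j ∧ δ j ≤ θ (i + 1)) then w else 0 :=
                fun j _ => by split_ifs <;> linarith
              split_ifs with h
              · obtain ⟨j, hj, hj2⟩ := h
                refine le_trans ?_ (Finset.single_le_sum nn hj)
                simp [hj2]
              · exact Finset.sum_nonneg nn
          _ = ∑ j ∈ (T t).queries x, ∑ i : Fin L,
              if (θ i < δ j ∧ δ j ≤ θ (i + 1)) then w else 0 := Finset.sum_comm
          _ ≤ ∑ j ∈ (T t).queries x, w := Finset.sum_le_sum fun j _ => h3 j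
          _ ≤ _ := by
              rw [Finset.sum_const, nsmul_eq_mul]
              have : (((T t).queries x).card : ℝ) ≤ q := by
                exact_mod_cast (DTree.queries_card _ _).trans (hT t)
              gcongr
      have h4 := h1.trans_le (Finset.sum_le_sum fun t _ => h2 t)
      simp only [Finset.sum_const, Finset.card_univ, nsmul_eq_mul, Fintype.card_fin] at h4
      have h5 : (Fintype.card ι : ℝ) * (q * w) = q := by
        rw [hw]; field_simp
      rw [h5, hL] at h4
      push_cast at h4
      linarith
    obtain ⟨i, hi⟩ := hex
    have h1 := (htails i (fun j => x j) x (f x)).2 (7 / 12) (by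
      have h2 : (∑ t, if (T t).eval x = some (f x) then w else 0) ≤
          (∑ t, if gd T δ (θ i) (f x) (K i) (fun j => x j) x t then w else 0) +
          (∑ t, if (∃ j ∈ (T t).queries x, θ i < δ j ∧ δ j ≤ θ (i + 1)) then w else 0) := by
        rw [← Finset.sum_add_distrib]
        refine Finset.sum_le_sum fun t _ => ?_
        by_cases ha : (T t).eval x = some (f x)
        · by_cases hb : ∃ j ∈ (T t).queries x, θ i < δ j ∧ δ j ≤ θ (i + 1)
          · simp only [ha, hb, if_true]
            split_ifs <;> linarith
          · have : gd T δ (θ i) (f x) (K i) (fun j => x j) x t := by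
              refine ⟨by rw [ovr_self]; exact ha, ?_⟩
              intro j hj
              unfold pet at hj
              rw [ovr_self] at hj
              by_contra hcon
              rw [Finset.mem_sdiff] at hj
              apply hb
              refine ⟨j, hj.1, not_le.1 hcon, ?_⟩
              by_contra hc
              apply hj.2
              simp only [hK, Finset.mem_filter, Finset.mem_univ, true_and]
              exact not_le.1 hc
            simp [ha, hb, this]
        · simp only [ha, if_false]
          split_ifs <;> linarith
      have := hV x hx
      linarith)
    have h2 : tl i ≤ 1 / 9 := by
      have h3 := hnum i i.2
      have h4 : (1 : ℝ) ≤ (Fintype.card A : ℝ) ^ (K i).card := by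
        have : Nonempty A := ⟨x ⟨0, by exact_mod_cast hnpos⟩⟩
        apply one_le_pow₀
        exact_mod_cast Fintype.card_pos
      have h5 : 0 < tl i := Real.exp_pos _
      have h6 : 1 / (9 * (L : ℝ)) ≤ 1 / 9 := by
        apply one_div_le_one_div_of_le (by norm_num)
        have : (1 : ℝ) ≤ L := by exact_mod_cast hLpos
        linarith
      nlinarith
    refine le_trans (bE_mono hp0.le hp1 _ fun Q => ?_) (h1.trans h2)
    by_cases hf : fires (f x) Q x
    · simp only [hf, not_true, if_false]
      split_ifs <;> norm_num
    · have : est p w (pet T (K i) (fun j => x j) x)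
          (gd T δ (θ i) (f x) (K i) (fun j => x j) x) Q ≤ 7 / 12 - 1 / 8 := by
        by_contra hc
        apply hf
        refine ⟨i, fun j => x j, ?_⟩
        norm_num at hc
        linarith
      simp only [this, if_true]
      split_ifs <;> norm_num
  have hcap : bE p (Finset.univ : Finset (Fin n)) (fun Q => if s < (Q.card : ℝ) then 1 else 0)
      ≤ 1 / 9 := by
    refine (bE_markov p hp0.le hp1 s hspos).trans ?_
    rw [hs, hp]
    have : (W ^ 2)⁻¹ * n / (n / W) = 1 / W := by field_simp
    rw [this]
    exact one_div_le_one_div_of_le (by norm_num) hW9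
  refine ⟨mkAlg p hp0.le hp1 dec ?_, ?_, ?_, ?_⟩
  · intro Q x y h
    simp only [hdec]
    simp only [hfloc true Q x y h, hfloc false Q x y h]
  · intro x hx
    rw [mkAlg_pr]
    have h1 := hwrong x (hVd hx)
    have h2 := hright x hx
    have h3 : bE p (Finset.univ : Finset (Fin n)) (fun _ => 1) ≤
        bE p Finset.univ (fun Q => (if dec Q x = some (f x) then 1 else 0) +
          ((if fires (!f x) Q x then 1 else 0) + ((if ¬ fires (f x) Q x then 1 else 0) +
            (if s < (Q.card : ℝ) then 1 else 0)))) := by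
      refine bE_mono hp0.le hp1 _ fun Q => ?_
      by_cases c1 : fires (!f x) Q x
      · simp only [c1, if_true]; split_ifs <;> norm_num
      by_cases c2 : fires (f x) Q x
      swap
      · simp only [c2, not_false_iff, if_true]; split_ifs <;> norm_num
      by_cases c3 : s < (Q.card : ℝ)
      · simp only [c3, if_true]; split_ifs <;> norm_num
      have : dec Q x = some (f x) := by
        simp only [hdec, c3, if_false]
        cases hfx : f x <;> simp only [hfx, Bool.not_true, Bool.not_false] at c1 c2 <;>
          simp [c1, c2]
      simp only [this, if_true]; split_ifs <;> norm_num
    rw [bE_one, bE_add, bE_add, bE_add] at h3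
    have h4 : 2 / 3 ≤ bE p Finset.univ (fun Q => if dec Q x = some (f x) then 1 else 0) := by
      linarith
    convert h4
  · intro x hx
    rw [mkAlg_pr]
    have h1 := hwrong x hx
    have h3 : bE p (Finset.univ : Finset (Fin n)) (fun _ => 1) ≤
        bE p Finset.univ (fun Q => (if dec Q x = some (f x) ∨ dec Q x = none then 1 else 0) +
          (if fires (!f x) Q x then 1 else 0)) := by
      refine bE_mono hp0.le hp1 _ fun Q => ?_
      by_cases c1 : fires (!f x) Q x
      · simp only [c1, if_true]; split_ifs <;> norm_num
      have : dec Q x = some (f x) ∨ dec Q x = none := by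
        simp only [hdec]
        cases hfx : f x <;> simp only [hfx, Bool.not_true, Bool.not_false] at c1 <;>
          simp only [c1, false_and, if_false, not_false_iff, and_true] <;>
          split_ifs <;> simp
      simp only [this, if_true]; split_ifs <;> norm_num
    rw [bE_one, bE_add] at h3
    have h4 : 2 / 3 ≤ bE p Finset.univ
        (fun Q => if dec Q x = some (f x) ∨ dec Q x = none then 1 else 0) := by
      linarith
    convert h4
  · intro Q hQ x y
    simp only [mkAlg, hdec, hQ, if_true]

lemma prP_eq {A : Type} {n : ℕ} (M : Multiset (DTree A n (Option Bool))) (x : Fin n → A)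
    (P : Option Bool → Prop) :
    prP M x P = ∑ t : M.ToType, if P ((t : DTree A n (Option Bool)).eval x)
      then ((Fintype.card M.ToType : ℕ) : ℝ)⁻¹ else 0 := by
  rw [← Finset.sum_filter, Finset.sum_const, nsmul_eq_mul, ← div_eq_mul_inv]
  unfold prP
  congr 2
  · conv_lhs => rw [← Multiset.map_univ_coe M]
    rw [Multiset.countP_map]
    rfl
  · simp

/-- **Main theorem for relaxed local algorithms.** For every `ρ > 0` there are a
constant `c > 0` and, for each locality `ℓ` and finite alphabet `Σ`, a threshold `n₀`
such that for all `n ≥ n₀`: every `(ρ₀,ρ₁)`-robust relaxed `ℓ`-local algorithm `M`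
(outputs in `{0,1,⊥}`, modeled as `Option Bool` with `⊥ = none`) computing
`f : Σⁿ ⇀ {0,1}` with error rate `1/3`, valid input set `V`, and `ρ₀, ρ₁ ≥ ρ` yields a
sample-based relaxed local algorithm `N` for `f` with the same valid inputs `V`, error
rate `1/3`, and sample complexity at most `n^(1 - 1/(c·ℓ²·log₂²(ℓ+2)))`. -/
theorem relaxed_robust_local_to_sample_based :
    ∀ ρ : ℝ, 0 < ρ →
    ∃ c : ℝ, 0 < c ∧
    ∀ (ℓ : ℕ) (A : Type) [Fintype A] [DecidableEq A],
    ∃ n₀ : ℕ, ∀ n : ℕ, n₀ ≤ n →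
    ∀ (dom V : Set ((Fin n) → A)) (f : ((Fin n) → A) → Bool) (ρ0 ρ1 : ℝ)
      (M : Multiset (DTree A n (Option Bool))),
      V ⊆ dom →
      M ≠ 0 →
      (∀ t ∈ M, DTree.depth t ≤ ℓ) →
      (∀ x ∈ V, 1 - 1/3 ≤ prP M x (· = some (f x))) →
      (∀ x ∈ dom, 1 - 1/3 ≤ prP M x (fun o => o = some (f x) ∨ o = none)) →
      (∀ x ∈ dom, ∀ w : (Fin n) → A,
        relDist w x ≤ (if f x then ρ1 else ρ0) →
          1 - 1/3 ≤ prP M w (fun o => o = some (f x) ∨ o = none)) →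
      ρ ≤ ρ0 → ρ ≤ ρ1 →
      ∃ N : SampleAlg A n (Option Bool),
        (∀ x ∈ V, 2/3 ≤ N.pr x (· = some (f x))) ∧
        (∀ x ∈ dom, 2/3 ≤ N.pr x (fun o => o = some (f x) ∨ o = none)) ∧
        N.complexityLE
          ((n : ℝ) ^ (1 - 1 / (c * (ℓ : ℝ) ^ 2 * (Real.logb 2 ((ℓ : ℝ) + 2)) ^ 2))) := by
  intro ρ hρ
  refine ⟨96, by norm_num, ?_⟩
  intro ℓ A _ _
  set q : ℕ := max ℓ 1 with hq
  have hq1 : 1 ≤ q := le_max_right _ _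
  set L : ℕ := 12 * q with hL
  set B : ℝ := (DTree.bd (Fintype.card A) q : ℝ) + 1 with hB
  set W0 : ℝ := max 9 (max (B / ρ) (128 * B * ((Fintype.card A) * B + 9 * L))) with hW0
  have hW09 : 9 ≤ W0 := le_max_left _ _
  refine ⟨⌈W0 ^ (8 * q * L)⌉₊, ?_⟩
  intro n hn dom V f ρ0 ρ1 M hVd hM hdepth hval _ hrob hρ0 hρ1
  have hn' : W0 ^ (8 * q * L) ≤ n := (Nat.le_ceil _).trans (by exact_mod_cast hn)
  have hn1 : (1 : ℝ) ≤ n := le_trans (one_le_pow₀ (by linarith)) hn'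
  have hkpos : 8 * q * L ≠ 0 := by positivity
  set W : ℝ := (n : ℝ) ^ (((8 * q * L : ℕ) : ℝ)⁻¹) with hW
  have hWn : W ^ (8 * q * L) = n := Real.rpow_inv_natCast_pow (by positivity) hkpos
  have hW0W : W0 ≤ W := by
    have hWnn : 0 ≤ W := by positivity
    refine le_of_not_gt fun h => ?_
    have := pow_lt_pow_left₀ h hWnn hkpos
    linarith
  have hne : Nonempty M.ToType := by
    rw [← Fintype.card_pos_iff]
    simpa [Nat.pos_iff_ne_zero] using hM
  obtain ⟨N, h1, h2, h3⟩ := core (A := A) q hq1 L hL n ρ B W hρ (by simp [hB]) (by simp [hB]) hWn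
    (hW09.trans hW0W)
    (((le_max_left _ _).trans (le_max_right _ _)).trans hW0W)
    (((le_max_right _ _).trans (le_max_right _ _)).trans hW0W)
    (fun t : M.ToType => (t : DTree A n (Option Bool)))
    (fun t => (hdepth _ (Multiset.coe_mem)).trans (le_max_left _ _)) _ rfl dom V f hVd
    (by
      intro x hx
      have := hval x hx
      rw [prP_eq] at this
      norm_num at this ⊢
      convert this)
    (by
      intro x hx y hy
      have := hrob x hx y (hy.trans (by split_ifs <;> assumption))
      rw [prP_eq] at this
      have hthis : 1 - 1 / 3 ≤ (∑ t : M.ToType,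
          if ((t : DTree A n (Option Bool)).eval y = some (f x) ∨
            (t : DTree A n (Option Bool)).eval y = none)
            then ((Fintype.card M.ToType : ℕ) : ℝ)⁻¹ else 0) := by
        convert this
      have hcard : (∑ t : M.ToType, ((Fintype.card M.ToType : ℕ) : ℝ)⁻¹) = 1 := by
        simp only [Finset.sum_const, Finset.card_univ, nsmul_eq_mul]
        exact mul_inv_cancel₀ (by positivity)
      have hle : (∑ t : M.ToType, if (t : DTree A n (Option Bool)).eval y = some (!f x)
            then ((Fintype.card M.ToType : ℕ) : ℝ)⁻¹ else 0) +
          (∑ t : M.ToType, if ((t : DTree A n (Option Bool)).eval y = some (f x) ∨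
            (t : DTree A n (Option Bool)).eval y = none)
            then ((Fintype.card M.ToType : ℕ) : ℝ)⁻¹ else 0) ≤
          ∑ t : M.ToType, ((Fintype.card M.ToType : ℕ) : ℝ)⁻¹ := by
        rw [← Finset.sum_add_distrib]
        refine Finset.sum_le_sum fun t _ => ?_
        have hnn : (0 : ℝ) ≤ ((Fintype.card M.ToType : ℕ) : ℝ)⁻¹ := by positivity
        by_cases hc : (t : DTree A n (Option Bool)).eval y = some (!f x)
        · simp [hc]
        · simp only [hc, if_false]
          split_ifs <;> linarith
      linarith)
  refine ⟨N, h1, h2, ?_⟩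
  intro Q hQ
  apply h3 Q
  refine lt_of_le_of_lt ?_ hQ
  have hWeq : (n : ℝ) / W = (n : ℝ) ^ (1 - ((8 * q * L : ℕ) : ℝ)⁻¹) := by
    rw [Real.rpow_sub (by linarith), Real.rpow_one]
  rw [hWeq]
  apply Real.rpow_le_rpow_of_exponent_le hn1
  have hkey : 1 / (96 * (ℓ : ℝ) ^ 2 * (Real.logb 2 ((ℓ : ℝ) + 2)) ^ 2) ≤
      ((8 * q * L : ℕ) : ℝ)⁻¹ := by
    rcases Nat.eq_zero_or_pos ℓ with h0 | hpos
    · have h0' : (ℓ : ℝ) = 0 := by exact_mod_cast h0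
      rw [h0']
      have : (0 : ℝ) ≤ ((8 * q * L : ℕ) : ℝ)⁻¹ := by positivity
      simpa using this
    · have hqℓ : q = ℓ := max_eq_left hpos
      have hℓ : (1 : ℝ) ≤ ℓ := by exact_mod_cast hpos
      have hlog : 1 ≤ Real.logb 2 ((ℓ : ℝ) + 2) := by
        rw [Real.le_logb_iff_rpow_le (by norm_num) (by linarith)]
        norm_num
      rw [one_div]
      apply inv_anti₀
      · have : 0 < 8 * q * L := Nat.pos_of_ne_zero hkpos
        exact_mod_cast this
      · have e : ((8 * q * L : ℕ) : ℝ) = 96 * (ℓ : ℝ) ^ 2 := by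
          rw [hL, hqℓ]; push_cast; ring
        rw [e]
        exact le_mul_of_one_le_right (by positivity) (one_le_pow₀ hlog)
  linarith
end
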